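/- Let n ≥ 3 and let L be an origin-symmetric, SO(n−1) invariant convex body in ℝⁿ of class C²₊, normalized so that a₀ⁿ[L] = 1 (equivalently T_L h_{𝔹ⁿ} = h_{𝔹ⁿ}). Then for all f₁,…,f_{n−1} ∈ C(𝕊^{n−1}): (a) at every u ∈ 𝕊^{n−1}, |D(D²T_L f₁(u),…,D²T_L f_{n−1}(u))| ≤ |(□_n T_L |f₁|)(u)| · ∏_{k=2}^{n−1}‖f_k‖_∞, and consequently ‖D(D²T_L f₁,…,D²T_L f_{n−1})‖_{L²} ≤ ‖f₁‖_{L²} ∏_{k=2}^{n−1}‖f_k‖_∞; (b) ‖D(D²T_L f₁,…,D²T_L f_{n−1})‖_∞ ≤ ∏_{k=1}^{n−1}‖f_k‖_∞. -/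

import Mathlib

open scoped InnerProductSpace Pointwise
open MeasureTheory Metric Filter Topology

noncomputable section

/-- Euclidean space `ℝⁿ`. -/
abbrev En (n : ℕ) := EuclideanSpace ℝ (Fin n)

namespace MinkIter

variable {n : ℕ}

/-- The unit sphere `𝕊^{n-1}` as a subtype. -/
abbrev Sph (n : ℕ) := Metric.sphere (0 : En n) 1

/-- Spherical Lebesgue measure on `𝕊^{n-1}`. -/
def sphVol (n : ℕ) : Measure (Sph n) := (volume : Measure (En n)).toSphere

/-- A fixed pole `ē ∈ 𝕊^{n-1}`. -/
def pole (n : ℕ) : En n :=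
  if h : 0 < n then EuclideanSpace.single (⟨0, h⟩ : Fin n) 1 else 0

/-- The support function of a convex body, as a function on all of `ℝⁿ`. -/
def supp (K : ConvexBody (En n)) (x : En n) : ℝ :=
  sSup ((fun y => ⟪x, y⟫_ℝ) '' (K : Set (En n)))

/-- The Euclidean unit ball `𝔹ⁿ` as a convex body. -/
def ballB (n : ℕ) : ConvexBody (En n) :=
  ⟨closedBall 0 1, convex_closedBall 0 1, isCompact_closedBall 0 1, ⟨0, by simp⟩⟩

/-- The dilate `c • K` of a convex body. -/
def scale (c : ℝ) (K : ConvexBody (En n)) : ConvexBody (En n) :=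
  ⟨c • (K : Set (En n)), K.convex.smul c, K.isCompact.smul c, K.nonempty.smul_set⟩

/-- The translate `K + x` of a convex body. -/
def translate (K : ConvexBody (En n)) (x : En n) : ConvexBody (En n) :=
  ⟨(fun y => x + y) '' (K : Set (En n)), K.convex.translate x,
    K.isCompact.image (continuous_add_left x), K.nonempty.image _⟩

/-- A linear isometry of `ℝⁿ` is a rotation (element of `SO(n)`) if it preserves
orientation. -/
def IsRotation (ρ : En n ≃ₗᵢ[ℝ] En n) : Prop :=
  0 < LinearMap.det (ρ.toLinearEquiv.toLinearMap)

/-- The image `ρ K` of a convex body under a linear isometry. -/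
def rotate (ρ : En n ≃ₗᵢ[ℝ] En n) (K : ConvexBody (En n)) : ConvexBody (En n) :=
  ⟨ρ '' (K : Set (En n)), K.convex.linear_image ρ.toLinearEquiv.toLinearMap,
    K.isCompact.image ρ.continuous, K.nonempty.image _⟩

/-- `Φ` is a Minkowski valuation: `ΦK + ΦL = Φ(K ∪ L) + Φ(K ∩ L)` whenever `K ∪ L`
is convex (Minkowski addition on the left). -/
def IsMinkowskiValuation (Φ : ConvexBody (En n) → ConvexBody (En n)) : Prop :=
  ∀ (K L : ConvexBody (En n)) (hu : Convex ℝ ((K : Set (En n)) ∪ (L : Set (En n))))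
    (hi : ((K : Set (En n)) ∩ (L : Set (En n))).Nonempty),
    Φ K + Φ L =
      Φ ⟨(K : Set (En n)) ∪ (L : Set (En n)), hu, K.isCompact.union L.isCompact,
          K.nonempty.inl⟩ +
      Φ ⟨(K : Set (En n)) ∩ (L : Set (En n)), K.convex.inter L.convex,
          K.isCompact.inter_right L.isCompact.isClosed, hi⟩

/-- `Φ` is translation invariant. -/
def TranslationInvariant (Φ : ConvexBody (En n) → ConvexBody (En n)) : Prop :=
  ∀ (K : ConvexBody (En n)) (x : En n), Φ (translate K x) = Φ K

/-- `Φ` is (positively) homogeneous of degree `i`. -/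
def HasDegree (i : ℕ) (Φ : ConvexBody (En n) → ConvexBody (En n)) : Prop :=
  ∀ (K : ConvexBody (En n)) (c : ℝ), 0 ≤ c → Φ (scale c K) = scale (c ^ i) (Φ K)

/-- `Φ` commutes with `SO(n)`. -/
def RotationEquivariant (Φ : ConvexBody (En n) → ConvexBody (En n)) : Prop :=
  ∀ ρ : En n ≃ₗᵢ[ℝ] En n, IsRotation ρ → ∀ K, Φ (rotate ρ K) = rotate ρ (Φ K)

/-- `Φ` is even: `Φ(-K) = ΦK`. -/
def IsEven (Φ : ConvexBody (En n) → ConvexBody (En n)) : Prop :=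
  ∀ K, Φ (scale (-1) K) = Φ K

/-- `Φ` is monotone w.r.t. set inclusion. -/
def MonotoneVal (Φ : ConvexBody (En n) → ConvexBody (En n)) : Prop :=
  ∀ K L : ConvexBody (En n), (K : Set (En n)) ⊆ (L : Set (En n)) →
    (Φ K : Set (En n)) ⊆ (Φ L : Set (En n))

/-- `Φ` is non-trivial: `ΦK ≠ {o}` for some `K`. -/
def NontrivialVal (Φ : ConvexBody (En n) → ConvexBody (En n)) : Prop :=
  ∃ K : ConvexBody (En n), (Φ K : Set (En n)) ≠ {0}

/-- The mixed volume `V(K₁,…,Kₙ)`, via polarization of the volume. -/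
def mixedVol (Ks : Fin n → ConvexBody (En n)) : ℝ :=
  ((n.factorial : ℝ))⁻¹ *
    ∑ S : Finset (Fin n), (-1 : ℝ) ^ (n - S.card) *
      (volume ((∑ k ∈ S, Ks k : ConvexBody (En n)) : Set (En n))).toReal

/-- `κ_m`, the volume of the `m`-dimensional unit ball. -/
def kappa (m : ℕ) : ℝ := (volume (closedBall (0 : En m) 1)).toReal

/-- `ω_m`, the surface area of the `m`-dimensional unit ball. -/
def omegaS (m : ℕ) : ℝ := m * kappa m

/-- The `j`-th intrinsic volume `V_j(K) = binom(n,j) V(K[j],𝔹ⁿ[n-j]) / κ_{n-j}`. -/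
def intrinsicVol (j : ℕ) (K : ConvexBody (En n)) : ℝ :=
  (n.choose j : ℝ) / kappa (n - j) *
    mixedVol (fun k : Fin n => if (k : ℕ) < j then K else ballB n)

/-- `μ` is the area measure of order `i` of `K`: for every convex body `L`,
`∫ h_L dμ = n V(L, K[i], 𝔹ⁿ[n-1-i])`. -/
def IsAreaMeasure (i : ℕ) (K : ConvexBody (En n)) (μ : Measure (Sph n)) : Prop :=
  ∀ L : ConvexBody (En n),
    (∫ v : Sph n, supp L (v : En n) ∂μ) =
      n * mixedVol (fun k : Fin n =>
        if (k : ℕ) = 0 then L else if (k : ℕ) ≤ i then K else ballB n)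

/-- `Φ` is generated by the zonal function with profile `g : [-1,1] → ℝ`, i.e.
`h_{ΦK} = S_i(K,·) ∗ g` where `∗` is the spherical convolution. -/
def GeneratedBy (i : ℕ) (Φ : ConvexBody (En n) → ConvexBody (En n)) (g : ℝ → ℝ) : Prop :=
  ∀ (K : ConvexBody (En n)) (μ : Measure (Sph n)), IsAreaMeasure i K μ →
    ∀ u : En n, ‖u‖ = 1 →
      supp (Φ K) u = ∫ v : Sph n, g ⟪u, (v : En n)⟫_ℝ ∂μ

/-- `L` is a body of revolution: invariant under all rotations fixing the pole. -/
def IsZonalBody (L : ConvexBody (En n)) : Prop :=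
  ∀ ρ : En n ≃ₗᵢ[ℝ] En n, IsRotation ρ → ρ (pole n) = pole n → rotate ρ L = L

/-- The quadratic form of the Hessian of `F` at `u` in direction `w`. -/
def hessQ (F : En n → ℝ) (u w : En n) : ℝ := iteratedFDeriv ℝ 2 F u ![w, w]

/-- `(j,l)` entry of the Hessian of `F` at `u`. -/
def hessE (F : En n → ℝ) (u : En n) (j l : Fin n) : ℝ :=
  iteratedFDeriv ℝ 2 F u ![EuclideanSpace.single j 1, EuclideanSpace.single l 1]

/-- A convex body is of class `C^k₊` if its support function is of class `C^k`
away from the origin and the restriction of its Hessian to `u^⊥` is positive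
definite for every unit vector `u`. -/
def IsCkPlus (k : ℕ∞) (L : ConvexBody (En n)) : Prop :=
  ContDiffOn ℝ k (supp L) {0}ᶜ ∧
    ∀ u : En n, ‖u‖ = 1 → ∀ w : En n, w ≠ 0 → ⟪u, w⟫_ℝ = 0 → 0 < hessQ (supp L) u w

/-- `Φ` is a `C^∞₊` regular Minkowski valuation of degree `i`: it is generated by
the support function of a body of revolution of class `C^∞₊`. -/
def CInfRegular (i : ℕ) (Φ : ConvexBody (En n) → ConvexBody (En n)) : Prop :=
  ∃ (L : ConvexBody (En n)) (g : ℝ → ℝ), IsZonalBody L ∧ IsCkPlus ⊤ L ∧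
    (∀ u : En n, ‖u‖ = 1 → supp L u = g ⟪u, pole n⟫_ℝ) ∧ GeneratedBy i Φ g

/-- The `C²(𝕊^{n-1})` distance of two functions. -/
def C2dist (F G : En n → ℝ) : ℝ :=
  ⨆ u : Sph n, (|F (u : En n) - G (u : En n)| +
    ‖fderiv ℝ F (u : En n) - fderiv ℝ G (u : En n)‖ +
    ‖iteratedFDeriv ℝ 2 F (u : En n) - iteratedFDeriv ℝ 2 G (u : En n)‖)

/-- The Legendre polynomial of dimension `d` and degree `k` (Rodrigues formula). -/
def legendreP (d k : ℕ) (t : ℝ) : ℝ :=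
  (-1 : ℝ) ^ k *
    (Real.Gamma (((d : ℝ) - 1) / 2) / (2 ^ k * Real.Gamma (((d : ℝ) - 1) / 2 + k))) *
    (1 - t ^ 2) ^ (-(((d : ℝ) - 3) / 2)) *
    iteratedDeriv k (fun s : ℝ => (1 - s ^ 2) ^ ((((d : ℝ) - 3) / 2) + (k : ℝ))) t

/-- The multiplier `a_k^d[h]` of a zonal function with profile `h : [-1,1] → ℝ`. -/
def multInt (d k : ℕ) (h : ℝ → ℝ) : ℝ :=
  omegaS (d - 1) *
    ∫ t in (-1 : ℝ)..1, legendreP d k t * h t * (1 - t ^ 2) ^ (((d : ℝ) - 3) / 2)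

/-- The multiplier `a_k^n[f] = ∫_{𝕊^{n-1}} f(u) P_k^n(ē·u) du` of a zonal function
`f` on the sphere. -/
def multSph (k : ℕ) (f : En n → ℝ) : ℝ :=
  ∫ u : Sph n, f (u : En n) * legendreP n k ⟪pole n, (u : En n)⟫_ℝ ∂(sphVol n)

/-- The projection `π₀ f` of `f` onto the constants (its mean value). -/
def proj0 (f : En n → ℝ) : ℝ :=
  (omegaS n)⁻¹ * ∫ u : Sph n, f (u : En n) ∂(sphVol n)

/-- The `L²(𝕊^{n-1})` norm. -/
def sphL2 (f : En n → ℝ) : ℝ :=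
  Real.sqrt (∫ u : Sph n, (f (u : En n)) ^ 2 ∂(sphVol n))

/-- The sup norm on the sphere. -/
def supSph (f : En n → ℝ) : ℝ := ⨆ u : Sph n, |f (u : En n)|

/-- `M ∈ UBounds α f` iff `M` witnesses `‖f‖_{𝒰_α} ≤ M`: `‖f‖_∞ ≤ M` and for every
`k ≥ 1` there is a polynomial of degree at most `k` with `‖f - p_k‖_{L²} ≤ M k^{-α}`. -/
def UBounds (α : ℝ) (f : En n → ℝ) : Set ℝ :=
  {M | (∀ u : En n, ‖u‖ = 1 → |f u| ≤ M) ∧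
    ∀ k : ℕ, 0 < k → ∃ p : MvPolynomial (Fin n) ℝ, p.totalDegree ≤ k ∧
      sphL2 (fun x => f x - MvPolynomial.eval (fun j => x j) p) ≤ M * (k : ℝ) ^ (-α)}

/-- `f ∈ 𝒰_α`. -/
def MemU (α : ℝ) (f : En n → ℝ) : Prop := (UBounds α f).Nonempty

/-- The norm `‖f‖_{𝒰_α}`. -/
def UNorm (α : ℝ) (f : En n → ℝ) : ℝ := sInf (UBounds α f)

/-- The convolution transform `T_g f` with zonal kernel of profile `g`, extended
1-homogeneously to `ℝⁿ`: `(T_g f)(u) = ∫_{𝕊^{n-1}} g(u·v) f(v) dv` for unit `u`. -/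
def Tg (g : ℝ → ℝ) (f : En n → ℝ) (x : En n) : ℝ :=
  ‖x‖ * ∫ v : Sph n, g ⟪‖x‖⁻¹ • x, (v : En n)⟫_ℝ * f (v : En n) ∂(sphVol n)

/-- The 0-homogeneous extension of a function on the sphere. -/
def zeroExt (f : En n → ℝ) (x : En n) : ℝ := f (‖x‖⁻¹ • x)

/-- The spherical Laplacian `Δ_𝕊 f`, i.e. the Euclidean Laplacian of the
0-homogeneous extension. -/
def sphLap (f : En n → ℝ) (u : En n) : ℝ := ∑ j : Fin n, hessE (zeroExt f) u j j

/-- The operator `□_n f = f + Δ_𝕊 f /(n-1)`. -/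
def boxN (f : En n → ℝ) (u : En n) : ℝ := f u + ((n : ℝ) - 1)⁻¹ * sphLap f u

/-- The mixed discriminant of `m` symmetric `m × m` matrices, via polarization of
the determinant. -/
def mixedDisc {m : ℕ} (A : Fin m → Matrix (Fin m) (Fin m) ℝ) : ℝ :=
  ((m.factorial : ℝ))⁻¹ *
    ∑ S : Finset (Fin m), (-1 : ℝ) ^ (m - S.card) * (∑ k ∈ S, A k).det

/-- The rank one matrix `u ⊗ u`. -/
def outer (u : En n) : Matrix (Fin n) (Fin n) ℝ := Matrix.of fun j l => u j * u l

/-- The matrix of the orthogonal projection onto `u^⊥`. -/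
def projMat (u : En n) : Matrix (Fin n) (Fin n) ℝ := 1 - outer u

/-- The Hessian matrix of `F` at `u`. -/
def hessMat (F : En n → ℝ) (u : En n) : Matrix (Fin n) (Fin n) ℝ :=
  Matrix.of fun j l => hessE F u j l

/-- The mixed discriminant `D_{n-1}(B₁|_{u^⊥},…,B_{n-1}|_{u^⊥})` of the restrictions
to `u^⊥` of matrices annihilating `u`, computed via the identity
`D_{n-1}(B₁|_{u^⊥},…) = n · D_n(u ⊗ u, B₁,…,B_{n-1})`. -/
def restrDisc (u : En n) (B : Fin (n - 1) → Matrix (Fin n) (Fin n) ℝ) : ℝ :=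
  n * mixedDisc (fun k : Fin n =>
    if h : (k : ℕ) = 0 then outer u else B ⟨(k : ℕ) - 1, by have := k.isLt; omega⟩)

/-- Total variation distance between two Borel measures on the sphere. -/
def dTV (μ ν : Measure (Sph n)) : ℝ :=
  ⨆ A : {A : Set (Sph n) // MeasurableSet A}, |(μ A).toReal - (ν A).toReal|

/-- Lévy–Prokhorov distance between two Borel measures on the sphere. -/
def dLP (μ ν : Measure (Sph n)) : ℝ :=
  sInf {ε : ℝ | 0 < ε ∧ ∀ A : Set (Sph n), MeasurableSet A →
    μ A ≤ ν (Metric.thickening ε A) + ENNReal.ofReal ε ∧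
    ν A ≤ μ (Metric.thickening ε A) + ENNReal.ofReal ε}

/-- Two convex bodies are homothetic: one is a translate of a positive dilate of
the other. -/
def Homothetic (K L : ConvexBody (En n)) : Prop :=
  ∃ (c : ℝ) (x : En n), 0 < c ∧ (L : Set (En n)) = x +ᵥ c • (K : Set (En n))

/-- The dimension of a convex body (dimension of its affine hull). -/
def bodyDim (K : ConvexBody (En n)) : ℕ :=
  Module.finrank ℝ (vectorSpan ℝ (K : Set (En n)))

/-- `K` is a Euclidean ball. -/
def IsBall (K : ConvexBody (En n)) : Prop :=
  ∃ (c : En n) (r : ℝ), 0 < r ∧ (K : Set (En n)) = closedBall c r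

/-- The mean width `w(K) = (2/ω_n) ∫_{𝕊^{n-1}} h_K`. -/
def meanWidth (K : ConvexBody (En n)) : ℝ :=
  2 / omegaS n * ∫ u : Sph n, supp K (u : En n) ∂(sphVol n)

/-- `N(n,k)`, the dimension of the space of spherical harmonics of dimension `n`
and degree `k`. -/
def Nnk (n k : ℕ) : ℝ :=
  (((n : ℝ) + 2 * k - 2) / ((n : ℝ) + k - 2)) * (Nat.choose (n + k - 2) (n - 2) : ℝ)

section MixedDiscriminant

open Finset Equiv
open scoped MatrixOrder

/-- The mixed discriminant as the symmetrization of the row-wise determinant. -/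
def mixedDiscMultilinear (m : ℕ) :
    MultilinearMap ℝ (fun _ : Fin m => Matrix (Fin m) (Fin m) ℝ) ℝ :=
  ((m.factorial : ℝ))⁻¹ • ∑ σ : Perm (Fin m),
    ((Matrix.detRowAlternating (n := Fin m) (R := ℝ)).toMultilinearMap.compLinearMap
      (fun j => ({ toFun := fun A => A j, map_add' := fun _ _ => rfl, map_smul' := fun _ _ => rfl } :
        Matrix (Fin m) (Fin m) ℝ →ₗ[ℝ] (Fin m → ℝ)))).domDomCongr σ

lemma mixedDiscMultilinear_apply {m : ℕ} (A : Fin m → Matrix (Fin m) (Fin m) ℝ) :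
    mixedDiscMultilinear m A =
      ((m.factorial : ℝ))⁻¹ * ∑ σ : Perm (Fin m), (Matrix.of fun i j => A (σ i) i j).det := by
  rw [mixedDiscMultilinear, smul_apply, _root_.sum_apply, smul_eq_mul]
  rfl

lemma sum_neg_one_pow_card_of_superset {m : ℕ} (T : Finset (Fin m)) :
    ∑ S : Finset (Fin m), (if T ⊆ S then (-1 : ℝ) ^ (m - S.card) else 0) =
      if T = univ then 1 else 0 := by
  have h1 : ∑ S : Finset (Fin m), (if T ⊆ S then (-1 : ℝ) ^ (m - S.card) else 0) =
      ∑ S : Finset (Fin m), (if S ⊆ Tᶜ then (-1 : ℝ) ^ S.card else 0) := by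
    refine Fintype.sum_equiv (Equiv.ofBijective _ (compl_bijective (α := Finset (Fin m)))) _ _ ?_
    intro S
    simp only [Equiv.ofBijective_apply, card_compl, Fintype.card_fin, compl_subset_compl]
  rw [h1, ← sum_filter]
  have h2 : (univ.filter fun S : Finset (Fin m) => S ⊆ Tᶜ) = Tᶜ.powerset := by
    ext S; simp
  have h3 := Finset.sum_powerset_neg_one_pow_card (x := Tᶜ)
  rw [h2]
  have h4 : ((∑ S ∈ Tᶜ.powerset, (-1 : ℤ) ^ S.card : ℤ) : ℝ) = if Tᶜ = ∅ then 1 else 0 := by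
    rw [h3]; split_ifs <;> simp
  push_cast at h4
  rw [h4]
  simp

lemma mixedDisc_eq_multilinear {m : ℕ} (A : Fin m → Matrix (Fin m) (Fin m) ℝ) :
    mixedDisc A = mixedDiscMultilinear m A := by
  classical
  rw [mixedDiscMultilinear_apply, mixedDisc]
  congr 1
  have hdet : ∀ S : Finset (Fin m), (∑ k ∈ S, A k).det =
      ∑ r : Fin m → Fin m, if univ.image r ⊆ S then
        (Matrix.of fun i j => A (r i) i j).det else 0 := by
    intro S
    have h1 : (∑ k ∈ S, A k).det =
        (Matrix.detRowAlternating (n := Fin m) (R := ℝ)).toMultilinearMap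
          (fun i => ∑ k ∈ S, A k i) := by
      change Matrix.det _ = Matrix.det _
      congr 1
      ext i j
      simp [Matrix.sum_apply]
    rw [h1, MultilinearMap.map_sum_finset, ← sum_filter]
    refine sum_congr ?_ fun r _ => rfl
    ext r
    simp [Fintype.mem_piFinset, Finset.subset_iff]
  simp_rw [hdet, mul_sum]
  rw [sum_comm]
  have hr : ∀ r : Fin m → Fin m,
      (∑ S : Finset (Fin m), (-1 : ℝ) ^ (m - S.card) * (if univ.image r ⊆ S then
        (Matrix.of fun i j => A (r i) i j).det else 0)) =
      if Function.Bijective r then (Matrix.of fun i j => A (r i) i j).det else 0 := by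
    intro r
    have := sum_neg_one_pow_card_of_superset (univ.image r)
    have h2 : (univ.image r = univ) ↔ Function.Bijective r := by
      rw [← Finite.surjective_iff_bijective, Finset.eq_univ_iff_forall]
      simp [Function.Surjective]
    rw [← ite_congr (propext h2) (fun _ => rfl) (fun _ => rfl),
      ← one_mul (Matrix.of fun i j => A (r i) i j).det, ← zero_mul (Matrix.of fun i j => A (r i) i j).det,
      ← ite_mul, ← this, sum_mul]
    refine sum_congr rfl fun S _ => ?_
    split_ifs <;> simp
  simp_rw [hr]
  rw [← sum_filter]
  symm
  refine sum_bij (fun (σ : Perm (Fin m)) _ => (σ : Fin m → Fin m)) ?_ ?_ ?_ ?_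
  · exact fun σ _ => mem_filter.mpr ⟨mem_univ _, σ.bijective⟩
  · intro σ _ τ _ h; exact DFunLike.coe_injective h
  · intro r hr
    exact ⟨Equiv.ofBijective r (by simpa using hr), by simp, rfl⟩
  · intro σ _; rfl

lemma mixedDiscMultilinear_vecMulVec_nonneg {m : ℕ} (v : Fin m → Fin m → ℝ) :
    0 ≤ mixedDiscMultilinear m (fun k => Matrix.vecMulVec (v k) (v k)) := by
  rw [mixedDiscMultilinear_apply]
  refine mul_nonneg (by positivity) ?_
  have h : ∀ σ : Perm (Fin m),
      (Matrix.of fun i j => Matrix.vecMulVec (v (σ i)) (v (σ i)) i j).det =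
        ((Perm.sign σ : ℤ) : ℝ) * (∏ i, v (σ i) i) * (Matrix.of v).det := by
    intro σ
    have h1 : (Matrix.of fun i j => Matrix.vecMulVec (v (σ i)) (v (σ i)) i j) =
        Matrix.of fun i j => v (σ i) i * ((Matrix.of v).submatrix σ id) i j := by
      ext i j; simp [Matrix.vecMulVec_apply]
    rw [h1, Matrix.det_mul_column, Matrix.det_permute]
    ring
  simp_rw [h]
  rw [← sum_mul]
  have h2 : ∑ σ : Perm (Fin m), ((Perm.sign σ : ℤ) : ℝ) * (∏ i, v (σ i) i) =
      (Matrix.of v).det := by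
    rw [Matrix.det_apply']
    rfl
  rw [h2]
  exact mul_self_nonneg _

lemma exists_sum_vecMulVec_of_posSemidef {m : ℕ} {A : Matrix (Fin m) (Fin m) ℝ}
    (hA : A.PosSemidef) :
    ∃ b : Fin m → Fin m → ℝ, A = ∑ i, Matrix.vecMulVec (b i) (b i) := by
  obtain ⟨B, rfl⟩ := CStarAlgebra.nonneg_iff_eq_star_mul_self.mp (Matrix.nonneg_iff_posSemidef.mpr hA)
  refine ⟨B, ?_⟩
  ext i j
  simp [Matrix.mul_apply, Matrix.sum_apply, Matrix.vecMulVec_apply, Matrix.star_eq_conjTranspose]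

lemma mixedDiscMultilinear_nonneg {m : ℕ} {A : Fin m → Matrix (Fin m) (Fin m) ℝ}
    (hA : ∀ k, (A k).PosSemidef) : 0 ≤ mixedDiscMultilinear m A := by
  choose b hb using fun k => exists_sum_vecMulVec_of_posSemidef (hA k)
  have h : A = fun k => ∑ i, Matrix.vecMulVec (b k i) (b k i) := funext hb
  rw [h, MultilinearMap.map_sum]
  exact sum_nonneg fun r _ => mixedDiscMultilinear_vecMulVec_nonneg _

lemma mixedDiscMultilinear_mono {m : ℕ} {A C : Fin m → Matrix (Fin m) (Fin m) ℝ}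
    (hA : ∀ k, (A k).PosSemidef) (hC : ∀ k, (C k - A k).PosSemidef) :
    mixedDiscMultilinear m A ≤ mixedDiscMultilinear m C := by
  classical
  have h : C = A + (C - A) := by simp
  rw [h, MultilinearMap.map_add_univ]
  refine le_trans (le_of_eq ?_) (single_le_sum (fun S _ => ?_) (mem_univ univ))
  · simp
  · refine mixedDiscMultilinear_nonneg fun k => ?_
    by_cases hk : k ∈ S <;> simp [hk, hA k, hC k]

/-- A multilinear form which is nonnegative on positive semidefinite matrices is controlled in
absolute value by any common majorant of the two parts of its arguments. -/
lemma abs_mixedDiscMultilinear_sub_le {m : ℕ} {P N C : Fin m → Matrix (Fin m) (Fin m) ℝ}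
    (hP : ∀ k, (P k).PosSemidef) (hN : ∀ k, (N k).PosSemidef)
    (hC : ∀ k, (C k - (P k + N k)).PosSemidef) :
    |mixedDiscMultilinear m (fun k => P k - N k)| ≤ mixedDiscMultilinear m C := by
  classical
  have hpw : ∀ S : Finset (Fin m), ∀ k, (S.piecewise P N k).PosSemidef := fun S k => by
    by_cases hk : k ∈ S <;> simp [hk, hP k, hN k]
  have h1 : mixedDiscMultilinear m (fun k => P k - N k) =
      ∑ S : Finset (Fin m), mixedDiscMultilinear m (S.piecewise P (-N)) := by
    rw [← MultilinearMap.map_add_univ]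
    congr 1
  have h2 : ∀ S : Finset (Fin m), |mixedDiscMultilinear m (S.piecewise P (-N))| =
      mixedDiscMultilinear m (S.piecewise P N) := by
    intro S
    have h3 : S.piecewise P (-N) =
        fun k => (if k ∈ S then (1 : ℝ) else -1) • S.piecewise P N k := by
      ext k : 1
      by_cases hk : k ∈ S <;> simp [hk]
    rw [h3, MultilinearMap.map_smul_univ, smul_eq_mul, abs_mul, abs_prod,
      abs_of_nonneg (mixedDiscMultilinear_nonneg (hpw S))]
    rw [prod_eq_one, one_mul]
    intro k _
    split_ifs <;> simp
  calc |mixedDiscMultilinear m (fun k => P k - N k)|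
      ≤ ∑ S : Finset (Fin m), mixedDiscMultilinear m (S.piecewise P N) := by
        rw [h1]
        exact (abs_sum_le_sum_abs _ _).trans (le_of_eq (sum_congr rfl fun S _ => h2 S))
    _ = mixedDiscMultilinear m (P + N) := (MultilinearMap.map_add_univ _ _ _).symm
    _ ≤ mixedDiscMultilinear m C :=
        mixedDiscMultilinear_mono (fun k => (hP k).add (hN k)) hC

lemma mixedDiscMultilinear_perm {m : ℕ} (A : Fin m → Matrix (Fin m) (Fin m) ℝ)
    (τ : Perm (Fin m)) :
    mixedDiscMultilinear m (fun k => A (τ k)) = mixedDiscMultilinear m A := by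
  rw [mixedDiscMultilinear_apply, mixedDiscMultilinear_apply]
  congr 1
  exact Fintype.sum_equiv (Equiv.mulLeft τ) _ _ fun σ => rfl

lemma det_one_updateRow_updateRow {m : ℕ} {i j : Fin m} (hij : i ≠ j) (x y : Fin m → ℝ) :
    (((1 : Matrix (Fin m) (Fin m) ℝ).updateRow i x).updateRow j y).det =
      x i * y j - x j * y i := by
  have h : ((1 : Matrix (Fin m) (Fin m) ℝ).updateRow i x).updateRow j y =
      1 + (Matrix.of fun (k : Fin m) (l : Fin 2) => if k = ![i, j] l then (1 : ℝ) else 0) *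
        (Matrix.of ![x - Pi.single i 1, y - Pi.single j 1]) := by
    ext k l
    rcases eq_or_ne k j with rfl | hkj
    · simp [Matrix.mul_apply, Fin.sum_univ_two, hij.symm, Matrix.one_apply, Pi.single_apply, eq_comm]
    · rcases eq_or_ne k i with rfl | hki
      · simp [Matrix.mul_apply, Fin.sum_univ_two, hkj, Matrix.one_apply, Pi.single_apply,
          eq_comm]
      · simp [Matrix.mul_apply, Fin.sum_univ_two, hkj, hki]
  rw [h, Matrix.det_one_add_mul_comm, Matrix.det_fin_two]
  have hentry : ∀ a b : Fin 2, ((Matrix.of ![x - Pi.single i 1, y - Pi.single j 1] :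
      Matrix (Fin 2) (Fin m) ℝ) * (Matrix.of fun (k : Fin m) (l : Fin 2) =>
        if k = ![i, j] l then (1 : ℝ) else 0)) a b =
      (![x - Pi.single i 1, y - Pi.single j 1] : Fin 2 → Fin m → ℝ) a (![i, j] b) := fun a b => by
    simp only [Matrix.mul_apply, Matrix.of_apply, mul_ite, mul_one, mul_zero, sum_ite_eq',
      mem_univ, if_true]
  simp only [Matrix.add_apply, hentry]
  simp [hij, hij.symm]

lemma mixedDiscMultilinear_update_update_one {m : ℕ} (X Y : Matrix (Fin m) (Fin m) ℝ)
    {k l : Fin m} (hkl : k ≠ l) :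
    (m * (m - 1) : ℝ) * mixedDiscMultilinear m
      (Function.update (Function.update (fun _ => 1) k X) l Y) =
      X.trace * Y.trace - (X * Y).trace := by
  have hsymm : ∀ p ∈ (univ : Finset (Fin m)).offDiag, mixedDiscMultilinear m
      (Function.update (Function.update (fun _ => 1) p.1 X) p.2 Y) = mixedDiscMultilinear m
      (Function.update (Function.update (fun _ => 1) k X) l Y) := by
    rintro ⟨i, j⟩ hp
    have hij : i ≠ j := by simpa using hp
    obtain ⟨τ, hτ⟩ : ∃ τ : Perm (Fin m), τ i = k ∧ τ j = l := by
      refine ⟨swap l (swap i k j) * swap i k, ?_, ?_⟩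
      · rw [Perm.mul_apply, swap_apply_left, swap_apply_of_ne_of_ne hkl]
        intro h
        apply hij
        have : swap i k i = swap i k j := by rw [swap_apply_left]; exact h
        exact (swap i k).injective this
      · simp
    rw [← mixedDiscMultilinear_perm (Function.update (Function.update (fun _ => 1) k X) l Y) τ]
    congr 1
    ext q : 1
    simp only [Function.update_apply, ← hτ.1, ← hτ.2, τ.injective.eq_iff]
  have hcard : (((univ : Finset (Fin m)).offDiag.card : ℕ) : ℝ) = m * (m - 1) := by
    rw [offDiag_card]
    simp only [card_univ, Fintype.card_fin]
    rw [Nat.cast_sub (Nat.le_mul_self m)]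
    push_cast; ring
  have hsum : ∑ p ∈ (univ : Finset (Fin m)).offDiag, mixedDiscMultilinear m
      (Function.update (Function.update (fun _ => 1) p.1 X) p.2 Y) =
      (m * (m - 1) : ℝ) * mixedDiscMultilinear m
      (Function.update (Function.update (fun _ => 1) k X) l Y) := by
    rw [sum_congr rfl hsymm, sum_const, nsmul_eq_mul, hcard]
  rw [← hsum]
  simp_rw [mixedDiscMultilinear_apply]
  rw [← mul_sum, sum_comm]
  have hσ : ∀ σ : Perm (Fin m), ∑ p ∈ (univ : Finset (Fin m)).offDiag,
      (Matrix.of fun i j =>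
        (Function.update (Function.update (fun _ => 1) p.1 X) p.2 Y : Fin m → _) (σ i) i j).det =
      X.trace * Y.trace - (X * Y).trace := by
    intro σ
    have h1 : ∑ p ∈ (univ : Finset (Fin m)).offDiag,
      (Matrix.of fun i j =>
        (Function.update (Function.update (fun _ => 1) p.1 X) p.2 Y : Fin m → _) (σ i) i j).det =
        ∑ p ∈ (univ : Finset (Fin m)).offDiag, (X p.1 p.1 * Y p.2 p.2 - X p.1 p.2 * Y p.2 p.1) := by
      refine sum_bij' (fun p _ => (σ.symm p.1, σ.symm p.2)) (fun p _ => (σ p.1, σ p.2))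
        ?_ ?_ ?_ ?_ ?_
      · rintro ⟨i, j⟩ h; simpa using h
      · rintro ⟨i, j⟩ h; simpa using h
      · rintro ⟨i, j⟩ h; simp
      · rintro ⟨i, j⟩ h; simp
      · rintro ⟨i, j⟩ h
        have hij : σ.symm i ≠ σ.symm j := by simpa using h
        rw [← det_one_updateRow_updateRow hij]
        congr 1
        ext a b
        have e1 : σ a = i ↔ a = σ.symm i := σ.eq_symm_apply.symm
        have e2 : σ a = j ↔ a = σ.symm j := σ.eq_symm_apply.symm
        simp only [Matrix.of_apply, Function.update_apply, e1, e2, Matrix.updateRow_apply]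
        split_ifs with h1 h2 <;> simp_all
    rw [h1]
    have h2 : ∑ p ∈ (univ : Finset (Fin m)).offDiag,
        (X p.1 p.1 * Y p.2 p.2 - X p.1 p.2 * Y p.2 p.1) =
        ∑ p ∈ (univ : Finset (Fin m)) ×ˢ (univ : Finset (Fin m)),
          (X p.1 p.1 * Y p.2 p.2 - X p.1 p.2 * Y p.2 p.1) := by
      rw [← diag_union_offDiag, sum_union (disjoint_diag_offDiag _)]
      rw [sum_eq_zero (s := diag _), zero_add]
      rintro ⟨i, j⟩ h
      have : i = j := by simpa using h
      subst this; ring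
    rw [h2, sum_sub_distrib, sum_product, sum_product]
    simp only [Matrix.trace, Matrix.mul_apply, Matrix.diag_apply, sum_mul_sum]
  simp_rw [hσ]
  rw [sum_const, card_univ, Fintype.card_perm, Fintype.card_fin, nsmul_eq_mul, ← mul_assoc,
    inv_mul_cancel₀ (by positivity), one_mul]

end MixedDiscriminant

section RestrictedDiscriminant

open Finset

lemma outer_posSemidef (u : En n) : (outer u).PosSemidef := by
  have h : outer u = Matrix.vecMulVec (fun i => u i) (star fun i => u i) := by
    ext i j; simp [outer, Matrix.vecMulVec_apply]
  rw [h]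
  exact Matrix.posSemidef_vecMulVec_self_star _

lemma trace_outer (u : En n) : (outer u).trace = ‖u‖ ^ 2 := by
  rw [EuclideanSpace.norm_sq_eq]
  simp [outer, Matrix.trace, pow_two]

lemma trace_outer_mul (u : En n) (Y : Matrix (Fin n) (Fin n) ℝ) :
    (outer u * Y).trace = ∑ i, ∑ j, Y i j * u i * u j := by
  simp only [Matrix.trace, Matrix.diag_apply, Matrix.mul_apply, outer, Matrix.of_apply]
  rw [sum_comm]
  refine sum_congr rfl fun i _ => sum_congr rfl fun j _ => by ring

/-- Comparison of a restricted mixed discriminant with one whose arguments are all scalar except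
for the first one. -/
lemma abs_restrDisc_sub_le {m : ℕ} {u : En (m + 3)} (hu : ‖u‖ = 1)
    {P N : Fin (m + 2) → Matrix (Fin (m + 3)) (Fin (m + 3)) ℝ}
    (hP : ∀ k, (P k).PosSemidef) (hN : ∀ k, (N k).PosSemidef)
    {Y : Matrix (Fin (m + 3)) (Fin (m + 3)) ℝ} {c : Fin (m + 2) → ℝ}
    (hY : (Y - (P 0 + N 0)).PosSemidef)
    (hc : ∀ k ≠ 0, (c k • (1 : Matrix (Fin (m + 3)) (Fin (m + 3)) ℝ) - (P k + N k)).PosSemidef) :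
    |restrDisc u (fun k => P k - N k)| ≤
      (((m : ℝ) + 2)⁻¹ * (Y.trace - ∑ i, ∑ j, Y i j * u i * u j)) * ∏ k ∈ univ.erase 0, c k := by
  classical
  have hfam : (fun k : Fin (m + 3) => if h : (k : ℕ) = 0 then outer u else
      (fun k : Fin (m + 2) => P k - N k) ⟨(k : ℕ) - 1, by have := k.isLt; omega⟩) =
      fun k => (Fin.cons (outer u) P : Fin (m + 3) → Matrix (Fin (m + 3)) (Fin (m + 3)) ℝ) k -
        (Fin.cons 0 N : Fin (m + 3) → Matrix (Fin (m + 3)) (Fin (m + 3)) ℝ) k := by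
    funext k
    refine Fin.cases ?_ (fun k => ?_) k
    · simp
    · simp
  have hmaj := abs_mixedDiscMultilinear_sub_le
    (P := (Fin.cons (outer u) P : Fin (m + 3) → Matrix (Fin (m + 3)) (Fin (m + 3)) ℝ))
    (N := (Fin.cons 0 N : Fin (m + 3) → Matrix (Fin (m + 3)) (Fin (m + 3)) ℝ))
    (C := (Fin.cons (outer u) (fun k => if k = 0 then Y else c k • 1) :
      Fin (m + 3) → Matrix (Fin (m + 3)) (Fin (m + 3)) ℝ))
    (fun k => by
      refine Fin.cases ?_ (fun k => ?_) k
      · simpa using outer_posSemidef u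
      · simpa using hP k)
    (fun k => by
      refine Fin.cases ?_ (fun k => ?_) k
      · simpa using Matrix.PosSemidef.zero
      · simpa using hN k)
    (fun k => by
      refine Fin.cases ?_ (fun k => ?_) k
      · simpa using Matrix.PosSemidef.zero
      · rcases eq_or_ne k 0 with rfl | hk
        · simpa using hY
        · simpa [hk] using hc k hk)
  have hC : (Fin.cons (outer u) (fun k => if k = 0 then Y else c k • 1) :
      Fin (m + 3) → Matrix (Fin (m + 3)) (Fin (m + 3)) ℝ) =
      fun k => (Fin.cons 1 (fun k => if k = 0 then 1 else c k) : Fin (m + 3) → ℝ) k •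
        (Function.update (Function.update (fun _ => 1) 0 (outer u)) 1 Y :
          Fin (m + 3) → Matrix (Fin (m + 3)) (Fin (m + 3)) ℝ) k := by
    funext k
    refine Fin.cases ?_ (fun k => ?_) k
    · simp
    · rcases eq_or_ne k 0 with rfl | hk
      · simp
      · have h1 : k.succ ≠ 1 := by
          rw [← Fin.succ_zero_eq_one]; exact fun h => hk (Fin.succ_injective _ h)
        simp [hk, h1]
  have hprod : ∏ k : Fin (m + 3), (Fin.cons 1 (fun k => if k = 0 then 1 else c k) :
      Fin (m + 3) → ℝ) k = ∏ k ∈ univ.erase (0 : Fin (m + 2)), c k := by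
    rw [Fin.prod_univ_succ]
    simp only [Fin.cons_zero, Fin.cons_succ, one_mul]
    rw [← mul_prod_erase univ _ (mem_univ (0 : Fin (m + 2)))]
    simp only [if_true, one_mul]
    exact prod_congr rfl fun k hk => if_neg (ne_of_mem_erase hk)
  have hval := mixedDiscMultilinear_update_update_one (outer u) Y
    (show (0 : Fin (m + 3)) ≠ 1 from by simp)
  rw [hC, MultilinearMap.map_smul_univ, hprod, smul_eq_mul] at hmaj
  rw [trace_outer, hu, trace_outer_mul] at hval
  have hdisc : restrDisc u (fun k => P k - N k) = ((m + 3 : ℕ) : ℝ) * mixedDiscMultilinear (m + 3)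
      (fun k => (Fin.cons (outer u) P : Fin (m + 3) → Matrix (Fin (m + 3)) (Fin (m + 3)) ℝ) k -
        (Fin.cons 0 N : Fin (m + 3) → Matrix (Fin (m + 3)) (Fin (m + 3)) ℝ) k) := by
    rw [← hfam, ← mixedDisc_eq_multilinear]
    rfl
  rw [hdisc, abs_mul, abs_of_nonneg (by positivity : (0 : ℝ) ≤ ((m + 3 : ℕ) : ℝ))]
  refine (mul_le_mul_of_nonneg_left hmaj (by positivity)).trans (le_of_eq ?_)
  push_cast at hval ⊢
  have hm : (m : ℝ) + 2 ≠ 0 := by positivity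
  field_simp
  linear_combination (∏ k ∈ univ.erase (0 : Fin (m + 2)), c k) * hval

end RestrictedDiscriminant

section PoleReflection

/-- The reflection of `ℝⁿ` exchanging the pole with the unit vector `v`. -/
@[irreducible]
def poleRefl (v : En n) : En n ≃ₗᵢ[ℝ] En n := (ℝ ∙ (pole n - v))ᗮ.reflection

/-- `poleRefl` as a continuous linear map. -/
def poleReflL (v : En n) : En n →L[ℝ] En n := (poleRefl v).toContinuousLinearEquiv

@[simp]
lemma poleReflL_apply (v x : En n) : poleReflL v x = poleRefl v x := rfl

lemma norm_poleReflL_le (v : En n) : ‖poleReflL v‖ ≤ 1 :=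
  ContinuousLinearMap.opNorm_le_bound _ zero_le_one fun x => by simp

lemma norm_pole (hn : 0 < n) : ‖pole n‖ = 1 := by
  simp [pole, hn]

lemma poleRefl_pole (hn : 0 < n) {v : En n} (hv : ‖v‖ = 1) : poleRefl v (pole n) = v :=
  by unfold poleRefl; exact Submodule.reflection_sub (by rw [norm_pole hn, hv])

lemma poleRefl_poleRefl (v x : En n) : poleRefl v (poleRefl v x) = x :=
  by unfold poleRefl; exact Submodule.reflection_reflection _ x

lemma inner_poleRefl_pole (hn : 0 < n) {v : En n} (hv : ‖v‖ = 1) (x : En n) :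
    ⟪poleRefl v x, pole n⟫_ℝ = ⟪x, v⟫_ℝ := by
  rw [← LinearIsometryEquiv.inner_map_map (poleRefl v), poleRefl_poleRefl, poleRefl_pole hn hv]

lemma poleRefl_ne_zero {v x : En n} (hx : x ≠ 0) : poleRefl v x ≠ 0 := by simpa using hx

lemma poleRefl_apply (v x : En n) :
    poleRefl v x = x - (2 * (⟪pole n - v, x⟫_ℝ / ‖pole n - v‖ ^ 2)) • (pole n - v) := by
  rw [poleRefl, Submodule.reflection_orthogonal_apply, Submodule.reflection_singleton_apply,
    neg_sub, mul_smul, ofNat_smul_eq_nsmul ℝ 2]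
  rfl

lemma measurable_poleRefl_coe (x : En n) : Measurable fun v : Sph n => poleRefl (v : En n) x := by
  simp_rw [poleRefl_apply]
  fun_prop

lemma measurable_poleReflL : Measurable fun v : En n => poleReflL v := by
  have h : ∀ v : En n, poleReflL v = ContinuousLinearMap.id ℝ (En n) -
      (2 / ‖pole n - v‖ ^ 2) • (innerSL ℝ (pole n - v)).smulRight (pole n - v) := by
    intro v
    ext1 x
    simp only [poleReflL_apply, poleRefl_apply, sub_apply,
      smul_apply, ContinuousLinearMap.smulRight_apply, innerSL_apply_apply,
      ContinuousLinearMap.id_apply, smul_smul]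
    congr 2
    ring
  simp_rw [h]
  have h1 : Continuous fun v : En n =>
      (innerSL ℝ (pole n - v)).smulRight (pole n - v) := by
    have := (ContinuousLinearMap.smulRightL ℝ (En n) (En n)).continuous₂
    exact this.comp (((innerSL ℝ).continuous.comp (by fun_prop)).prodMk (by fun_prop))
  have h2 : Measurable fun v : En n => 2 / ‖pole n - v‖ ^ 2 := by fun_prop
  exact measurable_const.sub (h2.smul h1.measurable)

end PoleReflection

section SphereMeasure

instance : IsFiniteMeasure (sphVol n) := by unfold sphVol; infer_instance

/-- The action of a linear isometry on the sphere. -/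
def sphMap (ρ : En n ≃ₗᵢ[ℝ] En n) (v : Sph n) : Sph n :=
  ⟨ρ v, by simp⟩

lemma measurePreserving_sphMap (ρ : En n ≃ₗᵢ[ℝ] En n) :
    MeasurePreserving (sphMap ρ) (sphVol n) (sphVol n) := by
  have hcont : Continuous (sphMap ρ) :=
    (ρ.continuous.comp continuous_subtype_val).subtype_mk _
  refine ⟨hcont.measurable, Measure.ext fun s hs => ?_⟩
  rw [Measure.map_apply hcont.measurable hs, sphVol,
    Measure.toSphere_apply' _ (hcont.measurable hs), Measure.toSphere_apply' _ hs]
  congr 1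
  rw [← ρ.measurePreserving.measure_preimage_emb ρ.toHomeomorph.measurableEmbedding
    (Set.Ioo (0 : ℝ) 1 • (Subtype.val '' s))]
  congr 1
  ext x
  simp only [Set.mem_smul, Set.mem_image, Set.mem_preimage]
  constructor
  · rintro ⟨t, ht, _, ⟨v, hv, rfl⟩, rfl⟩
    exact ⟨t, ht, _, ⟨sphMap ρ v, hv, rfl⟩, by simp [sphMap]⟩
  · rintro ⟨t, ht, _, ⟨v, hv, rfl⟩, hx⟩
    refine ⟨t, ht, _, ⟨sphMap ρ.symm v, ?_, rfl⟩, ?_⟩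
    · have : sphMap ρ (sphMap ρ.symm v) = v := Subtype.ext (by simp [sphMap])
      rwa [this]
    · apply ρ.injective
      rw [← hx]
      simp [sphMap]

lemma integral_sphere_comp (ρ : En n ≃ₗᵢ[ℝ] En n) (F : En n → ℝ) :
    ∫ v : Sph n, F (ρ v) ∂(sphVol n) = ∫ v : Sph n, F v ∂(sphVol n) := by
  have hcont : Continuous (sphMap ρ) :=
    (ρ.continuous.comp continuous_subtype_val).subtype_mk _
  have hinj : Function.Injective (sphMap ρ) := fun v w h =>
    Subtype.ext (ρ.injective (congrArg Subtype.val h))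
  exact (measurePreserving_sphMap ρ).integral_comp
    (hcont.measurableEmbedding hinj) (fun v : Sph n => F v)

lemma sphVol_singleton (hn : 2 ≤ n) (p : Sph n) : sphVol n {p} = 0 := by
  rw [sphVol, Measure.toSphere_apply' _ (measurableSet_singleton p)]
  have h : volume (Set.Ioo (0 : ℝ) 1 • (Subtype.val '' ({p} : Set (Sph n)))) = 0 := by
    refine measure_mono_null ?_ (Measure.addHaar_submodule volume (ℝ ∙ (p : En n)) ?_)
    · rintro _ ⟨t, -, _, ⟨v, rfl, rfl⟩, rfl⟩
      exact Submodule.smul_mem _ _ (Submodule.mem_span_singleton_self _)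
    · intro htop
      have h1 := finrank_span_singleton (K := ℝ) (v := (p : En n)) (by
        intro h0; have := p.2; simp [h0] at this)
      rw [htop, finrank_top] at h1
      simp at h1
      omega
  rw [h, mul_zero]

end SphereMeasure

section Differentiation

lemma exists_norm_le_of_annulus {V : Type*} [NormedAddCommGroup V] {ψ : En n → V} (hψ : ContinuousOn ψ {0}ᶜ)
    {a : ℝ} (ha : 0 < a) (b : ℝ) : ∃ C, 0 ≤ C ∧ ∀ y, a ≤ ‖y‖ → ‖y‖ ≤ b → ‖ψ y‖ ≤ C := by
  have hK : IsCompact (closedBall (0 : En n) b ∩ {y | a ≤ ‖y‖}) :=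
    (isCompact_closedBall 0 b).inter_right (isClosed_le continuous_const continuous_norm)
  obtain ⟨C, hC⟩ := hK.exists_bound_of_continuousOn (f := ψ) (hψ.mono fun y hy => by
    have h1 : a ≤ ‖y‖ := hy.2
    simpa using norm_pos_iff.1 (ha.trans_le h1))
  exact ⟨max C 0, le_max_right _ _, fun y h1 h2 =>
    (hC y ⟨by simpa using h2, h1⟩).trans (le_max_left _ _)⟩

lemma norm_smul_comp_fderiv_le {V W : Type*} [NormedAddCommGroup V] [NormedSpace ℝ V]
    [NormedAddCommGroup W] [NormedSpace ℝ W] {a c C : ℝ} (hac : |a| ≤ c) {M : V →L[ℝ] W} (hM : ‖M‖ ≤ 1)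
    (v : En n) {A : En n →L[ℝ] V} (hA : ‖A‖ ≤ C) : ‖a • (M ∘L A ∘L poleReflL (v : En n))‖ ≤ c * C := by
  rw [norm_smul]
  refine mul_le_mul hac ?_ (norm_nonneg _) ((abs_nonneg _).trans hac)
  calc _ ≤ ‖M‖ * (‖A‖ * ‖poleReflL v‖) :=
        (ContinuousLinearMap.opNorm_comp_le _ _).trans
          (mul_le_mul_of_nonneg_left (ContinuousLinearMap.opNorm_comp_le _ _) (norm_nonneg _))
    _ ≤ 1 * (C * 1) := by
        gcongr
        · exact (norm_nonneg _).trans hA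
        · exact norm_poleReflL_le _
    _ = C := by ring

variable {V W : Type*} [NormedAddCommGroup V] [NormedSpace ℝ V] [FiniteDimensional ℝ V]
  [NormedAddCommGroup W] [NormedSpace ℝ W] [FiniteDimensional ℝ W]

lemma integrable_fderiv_poleRefl {φ : Sph n → ℝ} (hφ : Measurable φ) {c : ℝ}
    (hφc : ∀ v, |φ v| ≤ c) {M : Sph n → V →L[ℝ] W} (hM : Measurable M) (hM1 : ∀ v, ‖M v‖ ≤ 1)
    {ψ : En n → V} (hψ : ContDiffOn ℝ 1 ψ {0}ᶜ) {x : En n} (hx : x ≠ 0) :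
    Integrable (fun v : Sph n => φ v • (M v ∘L fderiv ℝ ψ (poleRefl (v : En n) x) ∘L poleReflL (v : En n)))
      (sphVol n) := by
  have hψ' : ContinuousOn (fderiv ℝ ψ) {0}ᶜ :=
    hψ.continuousOn_fderiv_of_isOpen isOpen_compl_singleton le_rfl
  obtain ⟨C, hC0, hC⟩ := exists_norm_le_of_annulus hψ' (norm_pos_iff.2 hx) ‖x‖
  refine Integrable.of_bound (C := c * C) ?_ (ae_of_all _ fun v =>
    norm_smul_comp_fderiv_le (hφc v) (hM1 v) (v : En n) (hC (poleRefl (v : En n) x) (by simp) (by simp)))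
  have h1 : Measurable fun v : Sph n => fderiv ℝ ψ (poleRefl (v : En n) x) :=
    (measurable_fderiv ℝ ψ).comp (measurable_poleRefl_coe x)
  have h2 : Measurable fun v : Sph n => poleReflL (v : En n) :=
    measurable_poleReflL.comp measurable_subtype_coe
  refine hφ.aestronglyMeasurable.smul ?_
  refine (ContinuousLinearMap.compL ℝ (En n) V W).continuous₂.comp_aestronglyMeasurable
    (hM.aestronglyMeasurable.prodMk ?_)
  exact (ContinuousLinearMap.compL ℝ (En n) (En n) V).continuous₂.comp_aestronglyMeasurable
    (h1.aestronglyMeasurable.prodMk h2.aestronglyMeasurable)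

variable [MeasurableSpace V] [BorelSpace V]

lemma integrable_smul_poleRefl {φ : Sph n → ℝ} (hφ : Measurable φ) {c : ℝ}
    (hφc : ∀ v, |φ v| ≤ c) {M : Sph n → V →L[ℝ] W} (hM : Measurable M) (hM1 : ∀ v, ‖M v‖ ≤ 1)
    {ψ : En n → V} (hψ : ContinuousOn ψ {0}ᶜ) {x : En n} (hx : x ≠ 0) :
    Integrable (fun v : Sph n => φ v • M v (ψ (poleRefl (v : En n) x))) (sphVol n) := by
  obtain ⟨C, hC0, hC⟩ := exists_norm_le_of_annulus hψ (norm_pos_iff.2 hx) ‖x‖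
  have hψm : Measurable ψ := measurable_of_continuousOn_compl_singleton 0 hψ
  have hm : Measurable fun v : Sph n => ψ (poleRefl (v : En n) x) :=
    hψm.comp (measurable_poleRefl_coe x)
  refine Integrable.of_bound (C := c * C) ?_ (ae_of_all _ fun v => ?_)
  · refine hφ.aestronglyMeasurable.smul ?_
    exact (isBoundedBilinearMap_apply (𝕜 := ℝ) (E := V) (F := W)).continuous
      |>.comp_aestronglyMeasurable (hM.aestronglyMeasurable.prodMk hm.aestronglyMeasurable)
  · rw [norm_smul]
    have h1 : ‖M v (ψ (poleRefl (v : En n) x))‖ ≤ C := by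
      have := hC (poleRefl (v : En n) x) (by simp) (by simp)
      calc _ ≤ ‖M v‖ * ‖ψ (poleRefl (v : En n) x)‖ := (M v).le_opNorm _
        _ ≤ 1 * C := mul_le_mul (hM1 v) this (norm_nonneg _) zero_le_one
        _ = C := one_mul C
    exact mul_le_mul (hφc v) h1 (norm_nonneg _) ((abs_nonneg _).trans (hφc v))

lemma hasFDerivAt_integral_poleRefl {φ : Sph n → ℝ} (hφ : Measurable φ) {c : ℝ}
    (hφc : ∀ v, |φ v| ≤ c) {M : Sph n → V →L[ℝ] W} (hM : Measurable M) (hM1 : ∀ v, ‖M v‖ ≤ 1)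
    {ψ : En n → V} (hψ : ContDiffOn ℝ 1 ψ {0}ᶜ) {x : En n} (hx : x ≠ 0) :
    HasFDerivAt (fun x => ∫ v : Sph n, φ v • M v (ψ (poleRefl (v : En n) x)) ∂(sphVol n))
      (∫ v : Sph n, φ v • (M v ∘L fderiv ℝ ψ (poleRefl (v : En n) x) ∘L poleReflL (v : En n)) ∂(sphVol n)) x := by
  have hopen : IsOpen ({0}ᶜ : Set (En n)) := isOpen_compl_singleton
  have hx0 : 0 < ‖x‖ := norm_pos_iff.2 hx
  have hs : ball x (‖x‖ / 2) ∈ 𝓝 x := ball_mem_nhds x (by positivity)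
  have hball : ∀ y ∈ ball x (‖x‖ / 2), ‖x‖ / 2 ≤ ‖y‖ ∧ ‖y‖ ≤ 2 * ‖x‖ := by
    intro y hy
    rw [mem_ball_iff_norm] at hy
    have h1 := norm_sub_norm_le x y
    have h2 := norm_sub_norm_le y x
    rw [norm_sub_rev] at h1
    constructor <;> linarith
  have hne : ∀ y ∈ ball x (‖x‖ / 2), y ≠ 0 := fun y hy =>
    norm_pos_iff.1 ((half_pos hx0).trans_le (hball y hy).1)
  have hψ' : ContinuousOn (fderiv ℝ ψ) {0}ᶜ := hψ.continuousOn_fderiv_of_isOpen hopen le_rfl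
  obtain ⟨C, hC0, hC⟩ := exists_norm_le_of_annulus hψ' (half_pos hx0) (2 * ‖x‖)
  refine hasFDerivAt_integral_of_dominated_of_fderiv_le (bound := fun _ => c * C)
    (F' := fun x v => φ v • (M v ∘L fderiv ℝ ψ (poleRefl (v : En n) x) ∘L poleReflL (v : En n))) hs ?_ ?_ ?_ ?_ ?_ ?_
  · filter_upwards [hs] with y hy
    exact (integrable_smul_poleRefl hφ hφc hM hM1 hψ.continuousOn (hne y hy)).aestronglyMeasurable
  · exact integrable_smul_poleRefl hφ hφc hM hM1 hψ.continuousOn hx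
  · exact (integrable_fderiv_poleRefl hφ hφc hM hM1 hψ hx).aestronglyMeasurable
  · refine ae_of_all _ fun v y hy => ?_
    exact norm_smul_comp_fderiv_le (hφc v) (hM1 v) (v : En n)
      (hC (poleRefl (v : En n) y) (by simpa using (hball y hy).1) (by simpa using (hball y hy).2))
  · exact integrable_const _
  · refine ae_of_all _ fun v y hy => HasFDerivAt.const_smul ?_ _
    have h1 : HasFDerivAt ψ (fderiv ℝ ψ (poleRefl (v : En n) y)) (poleReflL (v : En n) y) :=
      ((hψ.differentiableOn one_ne_zero).differentiableAt
        (hopen.mem_nhds (poleRefl_ne_zero (hne y hy)))).hasFDerivAt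
    exact (M v).hasFDerivAt.comp y (h1.comp y (poleReflL (v : En n)).hasFDerivAt)

end Differentiation

section ZonalKernel

/-- The properties of the support function `H` of a normalized body of revolution of class `C²₊`
with profile `g` on which the estimates for the transform `Tg g` rest. -/
structure ZonalKernel (H : En n → ℝ) (g : ℝ → ℝ) : Prop where
  contDiffOn : ContDiffOn ℝ 2 H {0}ᶜ
  map_smul : ∀ t : ℝ, 0 < t → ∀ x, H (t • x) = t * H x
  profile : ∀ u : En n, ‖u‖ = 1 → H u = g ⟪u, pole n⟫_ℝ
  nonneg_of_orthogonal : ∀ u w : En n, ‖u‖ = 1 → ⟪u, w⟫_ℝ = 0 →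
    0 ≤ fderiv ℝ (fderiv ℝ H) u w w
  integral_eq_one : ∫ v : Sph n, H v ∂(sphVol n) = 1

/-- The composition of functionals with `poleRefl v`. -/
def precompPoleRefl (v : En n) : (En n →L[ℝ] ℝ) →L[ℝ] (En n →L[ℝ] ℝ) :=
  (ContinuousLinearMap.compL ℝ (En n) (En n) ℝ).flip (poleReflL v)

lemma precompPoleRefl_apply (v : En n) (A : En n →L[ℝ] ℝ) :
    precompPoleRefl v A = A ∘L poleReflL v := rfl

lemma norm_precompPoleRefl_le (v : En n) : ‖precompPoleRefl v‖ ≤ 1 :=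
  ContinuousLinearMap.opNorm_le_bound _ zero_le_one fun A => by
    rw [precompPoleRefl_apply, one_mul]
    calc _ ≤ ‖A‖ * ‖poleReflL v‖ := ContinuousLinearMap.opNorm_comp_le _ _
      _ ≤ ‖A‖ * 1 := by gcongr; exact norm_poleReflL_le v
      _ = ‖A‖ := mul_one _

lemma measurable_precompPoleRefl : Measurable fun v : Sph n => precompPoleRefl (v : En n) :=
  ((ContinuousLinearMap.compL ℝ (En n) (En n) ℝ).flip.continuous.measurable).comp
    (measurable_poleReflL.comp measurable_subtype_coe)

lemma continuous_coe_sphere {f : En n → ℝ} (hf : ContinuousOn f (sphere (0 : En n) 1)) :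
    Continuous fun v : Sph n => f v :=
  continuousOn_iff_continuous_domRestrict.1 hf

lemma bddAbove_range_abs {f : En n → ℝ} (hf : ContinuousOn f (sphere (0 : En n) 1)) :
    BddAbove (Set.range fun v : Sph n => |f v|) :=
  (isCompact_range (continuous_coe_sphere hf).abs).bddAbove

lemma abs_le_supSph {f : En n → ℝ} (hf : ContinuousOn f (sphere (0 : En n) 1)) (v : Sph n) :
    |f v| ≤ supSph f :=
  le_ciSup (bddAbove_range_abs hf) v

namespace ZonalKernel

variable {H : En n → ℝ} {g : ℝ → ℝ} (hH : ZonalKernel H g)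
include hH

lemma map_zero : H 0 = 0 := by
  have := hH.map_smul 2 two_pos 0
  rw [smul_zero] at this
  linarith

lemma continuousOn_fderiv_fderiv : ContinuousOn (fderiv ℝ (fderiv ℝ H)) {0}ᶜ :=
  (hH.contDiffOn.fderiv_of_isOpen isOpen_compl_singleton (m := 1)
    (by norm_num)).continuousOn_fderiv_of_isOpen isOpen_compl_singleton le_rfl

lemma Tg_eq_integral (hn : 0 < n) (f : En n → ℝ) (x : En n) :
    Tg g f x = ∫ v : Sph n, f v • H (poleRefl (v : En n) x) ∂(sphVol n) := by
  rcases eq_or_ne x 0 with rfl | hx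
  · simp [Tg, hH.map_zero]
  · have hx0 : 0 < ‖x‖ := norm_pos_iff.2 hx
    rw [Tg, ← integral_const_mul]
    refine integral_congr_ae (ae_of_all _ fun v => ?_)
    have h1 : ‖‖x‖⁻¹ • x‖ = 1 := by rw [norm_smul, norm_inv, norm_norm, inv_mul_cancel₀ hx0.ne']
    have h2 : H (poleRefl (v : En n) x) = ‖x‖ * g ⟪‖x‖⁻¹ • x, (v : En n)⟫_ℝ := by
      rw [← inner_poleRefl_pole hn (by simp), ← hH.profile _ (by rwa [LinearIsometryEquiv.norm_map]),
        ← hH.map_smul _ hx0, ← _root_.map_smul, smul_smul, mul_inv_cancel₀ hx0.ne', one_smul]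
    simp only [h2, smul_eq_mul]
    ring

variable {f : En n → ℝ} (hf : ContinuousOn f (sphere (0 : En n) 1))
include hf

lemma hasFDerivAt_Tg (hn : 0 < n) {x : En n} (hx : x ≠ 0) :
    HasFDerivAt (Tg g f)
      (∫ v : Sph n, f v • precompPoleRefl (v : En n) (fderiv ℝ H (poleRefl (v : En n) x)) ∂(sphVol n)) x := by
  have h := hasFDerivAt_integral_poleRefl (V := ℝ) (W := ℝ) (continuous_coe_sphere hf).measurable
    (abs_le_supSph hf) (M := fun _ => ContinuousLinearMap.id ℝ ℝ) measurable_const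
    (fun _ => ContinuousLinearMap.norm_id_le) (hH.contDiffOn.of_le one_le_two) hx
  exact h.congr_of_eventuallyEq (Eventually.of_forall fun y => hH.Tg_eq_integral hn f y)

lemma hasFDerivAt_fderiv_Tg (hn : 0 < n) {x : En n} (hx : x ≠ 0) :
    HasFDerivAt (fderiv ℝ (Tg g f))
      (∫ v : Sph n, f v • (precompPoleRefl (v : En n) ∘L fderiv ℝ (fderiv ℝ H) (poleRefl (v : En n) x) ∘L
        poleReflL (v : En n)) ∂(sphVol n)) x := by
  have h := hasFDerivAt_integral_poleRefl (V := En n →L[ℝ] ℝ) (W := En n →L[ℝ] ℝ)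
    (continuous_coe_sphere hf).measurable (abs_le_supSph hf)
    (M := fun v => precompPoleRefl (v : En n)) measurable_precompPoleRefl
    (fun v : Sph n => norm_precompPoleRefl_le (v : En n))
    (hH.contDiffOn.fderiv_of_isOpen isOpen_compl_singleton (m := 1) (by norm_num)) hx
  refine h.congr_of_eventuallyEq ?_
  filter_upwards [isOpen_compl_singleton.mem_nhds hx] with y hy
  exact (hH.hasFDerivAt_Tg hf hn hy).fderiv

lemma integrable_hess {x : En n} (hx : x ≠ 0) (y z : En n) :
    Integrable (fun v : Sph n => f v * fderiv ℝ (fderiv ℝ H) (poleRefl (v : En n) x)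
      (poleRefl (v : En n) y) (poleRefl (v : En n) z)) (sphVol n) := by
  have h := integrable_fderiv_poleRefl (V := En n →L[ℝ] ℝ) (W := En n →L[ℝ] ℝ)
    (continuous_coe_sphere hf).measurable (abs_le_supSph hf)
    (M := fun v => precompPoleRefl (v : En n)) measurable_precompPoleRefl
    (fun v : Sph n => norm_precompPoleRefl_le (v : En n))
    (hH.contDiffOn.fderiv_of_isOpen isOpen_compl_singleton (m := 1) (by norm_num)) hx
  exact (h.apply_continuousLinearMap y).apply_continuousLinearMap z

lemma fderiv_fderiv_Tg (hn : 0 < n) {x : En n} (hx : x ≠ 0) (y z : En n) :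
    fderiv ℝ (fderiv ℝ (Tg g f)) x y z =
      ∫ v : Sph n, f v * fderiv ℝ (fderiv ℝ H) (poleRefl (v : En n) x)
        (poleRefl (v : En n) y) (poleRefl (v : En n) z) ∂(sphVol n) := by
  have h := integrable_fderiv_poleRefl (V := En n →L[ℝ] ℝ) (W := En n →L[ℝ] ℝ)
    (continuous_coe_sphere hf).measurable (abs_le_supSph hf)
    (M := fun v => precompPoleRefl (v : En n)) measurable_precompPoleRefl
    (fun v : Sph n => norm_precompPoleRefl_le (v : En n))
    (hH.contDiffOn.fderiv_of_isOpen isOpen_compl_singleton (m := 1) (by norm_num)) hx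
  rw [(hH.hasFDerivAt_fderiv_Tg hf hn hx).fderiv, ContinuousLinearMap.integral_apply h,
    ContinuousLinearMap.integral_apply (h.apply_continuousLinearMap y)]
  rfl

end ZonalKernel
end ZonalKernel

section Hessian

lemma hessE_eq (F : En n → ℝ) (u : En n) (j l : Fin n) :
    hessE F u j l = fderiv ℝ (fderiv ℝ F) u (EuclideanSpace.single j 1)
      (EuclideanSpace.single l 1) := by
  rw [hessE, iteratedFDeriv_two_apply]
  rfl

lemma sum_smul_single (w : Fin n → ℝ) :
    ∑ j, w j • (EuclideanSpace.single j 1 : En n) = WithLp.toLp 2 w := by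
  ext i
  simp [Finset.sum_apply, Pi.single_apply]

lemma sum_bilin_single (B : En n →L[ℝ] En n →L[ℝ] ℝ) (x y : Fin n → ℝ) :
    ∑ i, ∑ j, B (EuclideanSpace.single i 1) (EuclideanSpace.single j 1) * x i * y j =
      B (WithLp.toLp 2 x) (WithLp.toLp 2 y) := by
  rw [← sum_smul_single x, ← sum_smul_single y, Finset.sum_comm]
  simp only [map_sum, map_smul, sum_apply, smul_apply, smul_eq_mul,
    Finset.mul_sum]
  refine Finset.sum_congr rfl fun i _ => Finset.sum_congr rfl fun j _ => ?_
  ring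

lemma posSemidef_of_bilin {B : En n →L[ℝ] En n →L[ℝ] ℝ} (hsymm : ∀ x y, B x y = B y x)
    (hnonneg : ∀ x, 0 ≤ B x x) :
    (Matrix.of fun i j : Fin n => B (EuclideanSpace.single i 1)
      (EuclideanSpace.single j 1)).PosSemidef := by
  refine Matrix.PosSemidef.of_dotProduct_mulVec_nonneg ?_ fun x => ?_
  · ext i j
    simp [Matrix.conjTranspose_apply, hsymm]
  · have h : star x ⬝ᵥ (Matrix.of fun i j : Fin n => B (EuclideanSpace.single i 1)
        (EuclideanSpace.single j 1)).mulVec x = B (WithLp.toLp 2 x) (WithLp.toLp 2 x) := by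
      rw [← sum_bilin_single]
      simp only [dotProduct, Matrix.mulVec, Matrix.of_apply, star_trivial, Finset.mul_sum]
      refine Finset.sum_congr rfl fun i _ => Finset.sum_congr rfl fun j _ => ?_
      ring
    rw [h]
    exact hnonneg _

lemma fderiv_smul_of_homogeneous {F : En n → ℝ} (hF : ∀ t : ℝ, 0 < t → ∀ x, F (t • x) = t * F x)
    {t : ℝ} (ht : 0 < t) (x : En n) : fderiv ℝ F (t • x) = fderiv ℝ F x := by
  have h1 : fderiv ℝ (fun y => F (t • y)) x = t • fderiv ℝ F (t • x) := fderiv_comp_smul ..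
  have h2 : (fun y => F (t • y)) = t • F := funext fun y => hF t ht y
  let := invertibleOfNonzero ht.ne'
  rw [h2, fderiv_const_smul_of_invertible] at h1
  exact (smul_right_injective _ ht.ne' h1).symm

lemma fderiv_fderiv_self_of_homogeneous {F : En n → ℝ}
    (hF : ∀ t : ℝ, 0 < t → ∀ x, F (t • x) = t * F x) {x : En n}
    (hx : DifferentiableAt ℝ (fderiv ℝ F) x) : fderiv ℝ (fderiv ℝ F) x x = 0 := by
  have h1 : HasDerivAt (fun t : ℝ => fderiv ℝ F (t • x)) (fderiv ℝ (fderiv ℝ F) x x) 1 := by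
    have h2 : HasDerivAt (fun t : ℝ => t • x) x 1 := by
      simpa using (hasDerivAt_id (1 : ℝ)).smul_const x
    have h3 : HasFDerivAt (fderiv ℝ F) (fderiv ℝ (fderiv ℝ F) x) ((1 : ℝ) • x) := by
      simpa using hx.hasFDerivAt
    exact h3.comp_hasDerivAt 1 h2
  have h2 : HasDerivAt (fun t : ℝ => fderiv ℝ F (t • x)) 0 1 := by
    refine (hasDerivAt_const (1 : ℝ) (fderiv ℝ F x)).congr_of_eventuallyEq ?_
    filter_upwards [lt_mem_nhds one_pos] with t ht
    exact fderiv_smul_of_homogeneous hF ht x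
  exact h1.unique h2

/-- The inner product as a continuous bilinear map. -/
def innerL (n : ℕ) : En n →L[ℝ] En n →L[ℝ] ℝ := innerSL ℝ

@[simp]
lemma innerL_apply (x y : En n) : innerL n x y = ⟪x, y⟫_ℝ := rfl

lemma hasFDerivAt_norm {x : En n} (hx : x ≠ 0) :
    HasFDerivAt (fun y : En n => ‖y‖) (‖x‖⁻¹ • innerL n x) x := by
  have h := ((hasStrictFDerivAt_norm_sq x).hasFDerivAt).sqrt (by simpa using hx)
  simp only [Real.sqrt_sq (norm_nonneg _)] at h
  refine h.congr_fderiv ?_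
  ext y
  simp
  ring

lemma hasFDerivAt_inv_norm {x : En n} (hx : x ≠ 0) :
    HasFDerivAt (fun y : En n => ‖y‖⁻¹) (-(‖x‖⁻¹ ^ 3) • innerL n x) x := by
  have h := (hasDerivAt_inv (norm_ne_zero_iff.2 hx)).comp_hasFDerivAt x (hasFDerivAt_norm hx)
  refine h.congr_fderiv ?_
  ext y
  simp
  ring

/-- The Hessian of the Euclidean norm at a unit vector is the projection onto its orthogonal
complement. -/
lemma fderiv_fderiv_norm {u : En n} (hu : ‖u‖ = 1) (y z : En n) :
    fderiv ℝ (fderiv ℝ fun x : En n => ‖x‖) u y z = ⟪y, z⟫_ℝ - ⟪u, y⟫_ℝ * ⟪u, z⟫_ℝ := by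
  have hu0 : u ≠ 0 := norm_ne_zero_iff.1 (by simp [hu])
  have h1 : HasFDerivAt (fun x : En n => ‖x‖⁻¹ • innerL n x)
      (‖u‖⁻¹ • innerL n + (-(‖u‖⁻¹ ^ 3) • innerL n u).smulRight (innerL n u)) u :=
    (hasFDerivAt_inv_norm hu0).smul (innerL n).hasFDerivAt
  have h2 : HasFDerivAt (fderiv ℝ fun x : En n => ‖x‖)
      (‖u‖⁻¹ • innerL n + (-(‖u‖⁻¹ ^ 3) • innerL n u).smulRight (innerL n u)) u := by
    refine h1.congr_of_eventuallyEq ?_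
    filter_upwards [isOpen_compl_singleton.mem_nhds hu0] with x hx
    exact (hasFDerivAt_norm hx).fderiv
  rw [h2.fderiv]
  simp [hu]
  ring

lemma sum_inner_single_sq (u : En n) :
    ∑ j, ⟪u, (EuclideanSpace.single j 1 : En n)⟫_ℝ ^ 2 = ‖u‖ ^ 2 := by
  simp [EuclideanSpace.norm_sq_eq, EuclideanSpace.inner_single_right]

/-- For a positively homogeneous function of degree one, the box operator is the normalized
Euclidean Laplacian. -/
lemma boxN_eq_of_homogeneous (hn : 2 ≤ n) {F : En n → ℝ}
    (hF : ∀ t : ℝ, 0 < t → ∀ x, F (t • x) = t * F x) (hd : ∀ x, x ≠ 0 → DifferentiableAt ℝ F x)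
    {u : En n} (hu : ‖u‖ = 1) (hdd : DifferentiableAt ℝ (fderiv ℝ F) u) :
    boxN F u = ((n : ℝ) - 1)⁻¹ * (hessMat F u).trace := by
  have hu0 : u ≠ 0 := norm_ne_zero_iff.1 (by simp [hu])
  have hext : ∀ x : En n, x ≠ 0 → zeroExt F x = ‖x‖⁻¹ * F x := fun x hx =>
    hF _ (by positivity) x
  have hnhds : {0}ᶜ ∈ 𝓝 u := isOpen_compl_singleton.mem_nhds hu0
  have h1 : ∀ x : En n, x ≠ 0 → HasFDerivAt (zeroExt F)
      (‖x‖⁻¹ • fderiv ℝ F x + F x • (-(‖x‖⁻¹ ^ 3) • innerL n x)) x := by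
    intro x hx
    refine ((hasFDerivAt_inv_norm hx).mul (hd x hx).hasFDerivAt).congr_of_eventuallyEq ?_
    filter_upwards [isOpen_compl_singleton.mem_nhds hx] with y hy
    exact hext y hy
  have hself : fderiv ℝ F u u = F u := by
    have h2 : HasDerivAt (fun t : ℝ => F (t • u)) (fderiv ℝ F u u) 1 := by
      have h2 : HasDerivAt (fun t : ℝ => t • u) u 1 := by
        simpa using (hasDerivAt_id (1 : ℝ)).smul_const u
      have h3 : HasFDerivAt F (fderiv ℝ F u) ((1 : ℝ) • u) := by
        simpa using (hd u hu0).hasFDerivAt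
      exact h3.comp_hasDerivAt 1 h2
    have h3 : HasDerivAt (fun t : ℝ => F (t • u)) (F u) 1 := by
      have h4 : HasDerivAt (fun t : ℝ => t * F u) (F u) 1 := by
        simpa using (hasDerivAt_id (1 : ℝ)).mul_const (F u)
      refine h4.congr_of_eventuallyEq ?_
      filter_upwards [lt_mem_nhds one_pos] with t ht
      exact hF t ht u
    exact h2.unique h3
  have hN := hasFDerivAt_inv_norm hu0
  have h2 := (hN.fun_smul hdd.hasFDerivAt).fun_add
    ((hd u hu0).hasFDerivAt.fun_smul (((hN.pow 3).fun_neg).fun_smul (innerL n).hasFDerivAt))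
  have h3 : HasFDerivAt (fderiv ℝ (zeroExt F)) _ u := h2.congr_of_eventuallyEq (by
    filter_upwards [hnhds] with x hx
    exact (h1 x hx).fderiv)
  have h4 : ∀ y, fderiv ℝ (fderiv ℝ (zeroExt F)) u y y = fderiv ℝ (fderiv ℝ F) u y y
      - 2 * (⟪u, y⟫_ℝ * fderiv ℝ F u y) + 3 * F u * ⟪u, y⟫_ℝ ^ 2 - F u * ⟪y, y⟫_ℝ := by
    intro y
    rw [h3.fderiv]
    simp [hu]
    ring
  have hgrad : ∑ j, ⟪u, (EuclideanSpace.single j 1 : En n)⟫_ℝ *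
      fderiv ℝ F u (EuclideanSpace.single j 1) = F u := by
    rw [← hself]
    conv_rhs => arg 2; rw [show u = WithLp.toLp 2 (u.ofLp) from rfl, ← sum_smul_single]
    simp [EuclideanSpace.inner_single_right]
  have h5 : sphLap F u = (hessMat F u).trace - ((n : ℝ) - 1) * F u := by
    rw [sphLap, Matrix.trace]
    simp only [Matrix.diag_apply, hessMat, Matrix.of_apply, hessE_eq, h4]
    rw [Finset.sum_sub_distrib, Finset.sum_add_distrib, Finset.sum_sub_distrib, ← Finset.mul_sum,
      hgrad, ← Finset.mul_sum, sum_inner_single_sq, hu]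
    simp
    ring
  have hn1 : (n : ℝ) - 1 ≠ 0 := by
    have : (2 : ℝ) ≤ n := by exact_mod_cast hn
    linarith
  rw [boxN, h5]
  field_simp
  ring

end Hessian

section Transform

lemma Tg_smul (g : ℝ → ℝ) (f : En n → ℝ) (t : ℝ) (ht : 0 < t) (x : En n) :
    Tg g f (t • x) = t * Tg g f x := by
  have h : ‖t • x‖⁻¹ • t • x = ‖x‖⁻¹ • x := by
    rw [norm_smul, Real.norm_of_nonneg ht.le, smul_smul, mul_inv, mul_right_comm,
      inv_mul_cancel₀ ht.ne', one_mul]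
  rw [Tg, Tg, h, norm_smul, Real.norm_of_nonneg ht.le, mul_assoc]

lemma hessMat_eq (F : En n → ℝ) (u : En n) :
    hessMat F u = Matrix.of fun i j : Fin n => fderiv ℝ (fderiv ℝ F) u
      (EuclideanSpace.single i 1) (EuclideanSpace.single j 1) := by
  ext i j
  simp [hessMat, hessE_eq]

lemma sum_hessMat_mul_mul (F : En n → ℝ) (u x : En n) :
    ∑ i, ∑ j, hessMat F u i j * x i * x j = fderiv ℝ (fderiv ℝ F) u x x := by
  simp only [hessMat_eq, Matrix.of_apply]
  exact sum_bilin_single _ _ _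

namespace ZonalKernel

variable {H : En n → ℝ} {g : ℝ → ℝ} (hH : ZonalKernel H g)
include hH

lemma differentiableAt {x : En n} (hx : x ≠ 0) : DifferentiableAt ℝ H x :=
  (hH.contDiffOn.differentiableOn two_ne_zero).differentiableAt
    (isOpen_compl_singleton.mem_nhds hx)

lemma differentiableAt_fderiv {x : En n} (hx : x ≠ 0) : DifferentiableAt ℝ (fderiv ℝ H) x :=
  ((hH.contDiffOn.fderiv_of_isOpen isOpen_compl_singleton (m := 1)
    (by norm_num)).differentiableOn one_ne_zero).differentiableAt
    (isOpen_compl_singleton.mem_nhds hx)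

lemma hess_symm {x : En n} (hx : x ≠ 0) (y z : En n) :
    fderiv ℝ (fderiv ℝ H) x y z = fderiv ℝ (fderiv ℝ H) x z y := by
  refine second_derivative_symmetric_of_eventually (f := H) (f' := fderiv ℝ H) ?_
    (hH.differentiableAt_fderiv hx).hasFDerivAt y z
  filter_upwards [isOpen_compl_singleton.mem_nhds hx] with y hy
  exact (hH.differentiableAt hy).hasFDerivAt

lemma hess_self {x : En n} (hx : x ≠ 0) : fderiv ℝ (fderiv ℝ H) x x = 0 :=
  fderiv_fderiv_self_of_homogeneous hH.map_smul (hH.differentiableAt_fderiv hx)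

lemma hess_nonneg {u : En n} (hu : ‖u‖ = 1) (w : En n) : 0 ≤ fderiv ℝ (fderiv ℝ H) u w w := by
  have hu0 : u ≠ 0 := norm_ne_zero_iff.1 (by simp [hu])
  have h := hH.nonneg_of_orthogonal u (w - ⟪u, w⟫_ℝ • u) hu (by
    rw [inner_sub_right, inner_smul_right, real_inner_self_eq_norm_sq, hu]; ring)
  have h1 : fderiv ℝ (fderiv ℝ H) u w u = 0 := by
    rw [hH.hess_symm hu0, hH.hess_self hu0]; rfl
  simpa [hH.hess_self hu0, h1] using h

lemma Tg_one (hn : 0 < n) : Tg g (fun _ => 1) = fun x : En n => ‖x‖ := by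
  ext x
  rcases eq_or_ne x 0 with rfl | hx
  · simp [Tg]
  set e : En n := ‖x‖⁻¹ • x
  have he : ‖e‖ = 1 := by
    simpa [e] using norm_smul_inv_norm (𝕜 := ℝ) hx
  have h : ∀ v : Sph n, g ⟪e, (v : En n)⟫_ℝ = H (poleRefl e v) := by
    intro v
    rw [hH.profile _ (by simp), inner_poleRefl_pole hn he, real_inner_comm]
  simp only [Tg, mul_one]
  simp_rw [show ‖x‖⁻¹ • x = e from rfl, h]
  rw [integral_sphere_comp (poleRefl e) H, hH.integral_eq_one, mul_one]

lemma integral_hess (hn : 0 < n) {u : En n} (hu : ‖u‖ = 1) (y z : En n) :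
    ∫ v : Sph n, fderiv ℝ (fderiv ℝ H) (poleRefl (v : En n) u) (poleRefl (v : En n) y)
      (poleRefl (v : En n) z) ∂(sphVol n) = ⟪y, z⟫_ℝ - ⟪u, y⟫_ℝ * ⟪u, z⟫_ℝ := by
  have hu0 : u ≠ 0 := norm_ne_zero_iff.1 (by simp [hu])
  rw [← fderiv_fderiv_norm hu, ← hH.Tg_one hn,
    hH.fderiv_fderiv_Tg continuousOn_const hn hu0]
  simp only [one_mul]

variable {f : En n → ℝ} (hf : ContinuousOn f (sphere (0 : En n) 1))
include hf

lemma fderiv_fderiv_Tg_symm (hn : 0 < n) {u : En n} (hu : ‖u‖ = 1) (y z : En n) :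
    fderiv ℝ (fderiv ℝ (Tg g f)) u y z = fderiv ℝ (fderiv ℝ (Tg g f)) u z y := by
  have hu0 : u ≠ 0 := norm_ne_zero_iff.1 (by simp [hu])
  rw [hH.fderiv_fderiv_Tg hf hn hu0, hH.fderiv_fderiv_Tg hf hn hu0]
  refine integral_congr_ae (ae_of_all _ fun v => ?_)
  simp only [hH.hess_symm (poleRefl_ne_zero hu0) (poleRefl (v : En n) y)]

lemma sum_hessMat_Tg_self (hn : 0 < n) {u : En n} (hu : ‖u‖ = 1) :
    ∑ i, ∑ j, hessMat (Tg g f) u i j * u i * u j = 0 := by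
  have hu0 : u ≠ 0 := norm_ne_zero_iff.1 (by simp [hu])
  rw [sum_hessMat_mul_mul, hH.fderiv_fderiv_Tg hf hn hu0]
  simp [hH.hess_self (poleRefl_ne_zero hu0)]

lemma posSemidef_hessMat_Tg (hn : 0 < n) (hf0 : ∀ v : Sph n, 0 ≤ f v) {u : En n} (hu : ‖u‖ = 1) :
    (hessMat (Tg g f) u).PosSemidef := by
  have hu0 : u ≠ 0 := norm_ne_zero_iff.1 (by simp [hu])
  rw [hessMat_eq]
  refine posSemidef_of_bilin (hH.fderiv_fderiv_Tg_symm hf hn hu) fun x => ?_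
  rw [hH.fderiv_fderiv_Tg hf hn hu0]
  exact integral_nonneg fun v => mul_nonneg (hf0 v) (hH.hess_nonneg (by simpa using hu) _)

lemma posSemidef_smul_one_sub_hessMat_Tg (hn : 0 < n) {c : ℝ} (hc : 0 ≤ c)
    (hfc : ∀ v : Sph n, f v ≤ c) {u : En n} (hu : ‖u‖ = 1) :
    (c • (1 : Matrix (Fin n) (Fin n) ℝ) - hessMat (Tg g f) u).PosSemidef := by
  have hu0 : u ≠ 0 := norm_ne_zero_iff.1 (by simp [hu])
  have h : c • (1 : Matrix (Fin n) (Fin n) ℝ) - hessMat (Tg g f) u =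
      Matrix.of fun i j : Fin n => (c • innerL n - fderiv ℝ (fderiv ℝ (Tg g f)) u)
        (EuclideanSpace.single i 1) (EuclideanSpace.single j 1) := by
    ext i j
    simp [hessMat_eq, EuclideanSpace.inner_single_left, Matrix.one_apply]
  rw [h]
  refine posSemidef_of_bilin (fun x y => ?_) fun x => ?_
  · simp [hH.fderiv_fderiv_Tg_symm hf hn hu x y, real_inner_comm x y]
  · have h1 : fderiv ℝ (fderiv ℝ (Tg g f)) u x x ≤ c * (⟪x, x⟫_ℝ - ⟪u, x⟫_ℝ * ⟪u, x⟫_ℝ) := by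
      rw [hH.fderiv_fderiv_Tg hf hn hu0, ← hH.integral_hess hn hu, ← integral_const_mul]
      refine integral_mono (hH.integrable_hess hf hu0 x x)
        (hH.integrable_hess (f := fun _ => c) continuousOn_const hu0 x x) fun v => ?_
      exact mul_le_mul_of_nonneg_right (hfc v) (hH.hess_nonneg (by simpa using hu) _)
    have h2 : 0 ≤ c * (⟪u, x⟫_ℝ * ⟪u, x⟫_ℝ) := mul_nonneg hc (mul_self_nonneg _)
    simp only [sub_apply, smul_apply, innerL_apply, smul_eq_mul]
    linarith

lemma boxN_Tg_eq_trace (hn : 2 ≤ n) {u : En n} (hu : ‖u‖ = 1) :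
    boxN (Tg g f) u = ((n : ℝ) - 1)⁻¹ * (hessMat (Tg g f) u).trace := by
  have hn0 : 0 < n := by omega
  exact boxN_eq_of_homogeneous hn (Tg_smul g f)
    (fun x hx => (hH.hasFDerivAt_Tg hf hn0 hx).differentiableAt) hu
    (hH.hasFDerivAt_fderiv_Tg hf hn0 (norm_ne_zero_iff.1 (by simp [hu]))).differentiableAt

end ZonalKernel
end Transform

section Bounds

lemma supSph_nonneg (f : En n → ℝ) : 0 ≤ supSph f :=
  Real.iSup_nonneg fun _ => abs_nonneg _

namespace ZonalKernel

variable {H : En n → ℝ} {g : ℝ → ℝ}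

lemma hessMat_Tg_add (hH : ZonalKernel H g) (hn : 0 < n) {f h : En n → ℝ}
    (hf : ContinuousOn f (sphere (0 : En n) 1)) (hh : ContinuousOn h (sphere (0 : En n) 1))
    {u : En n} (hu : ‖u‖ = 1) :
    hessMat (Tg g fun x => f x + h x) u = hessMat (Tg g f) u + hessMat (Tg g h) u := by
  have hu0 : u ≠ 0 := norm_ne_zero_iff.1 (by simp [hu])
  have hfh : ContinuousOn (fun x => f x + h x) (sphere (0 : En n) 1) := hf.add hh
  ext i j
  simp only [hessMat_eq, Matrix.add_apply, Matrix.of_apply, hH.fderiv_fderiv_Tg hf hn hu0,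
    hH.fderiv_fderiv_Tg hh hn hu0, hH.fderiv_fderiv_Tg hfh hn hu0]
  rw [← integral_add (hH.integrable_hess hf hu0 _ _) (hH.integrable_hess hh hu0 _ _)]
  simp only [add_mul]

lemma abs_restrDisc_le {m : ℕ} {H : En (m + 3) → ℝ} (hH : ZonalKernel H g)
    {f : Fin (m + 2) → En (m + 3) → ℝ}
    (hf : ∀ k, ContinuousOn (f k) (sphere (0 : En (m + 3)) 1)) {u : En (m + 3)} (hu : ‖u‖ = 1)
    {Y : Matrix (Fin (m + 3)) (Fin (m + 3)) ℝ}
    (hY : (Y - hessMat (Tg g fun x => |f 0 x|) u).PosSemidef) :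
    |restrDisc u fun k => hessMat (Tg g (f k)) u| ≤
      (((m : ℝ) + 2)⁻¹ * (Y.trace - ∑ i, ∑ j, Y i j * u i * u j)) *
        ∏ k ∈ Finset.univ.erase 0, supSph (f k) := by
  have hn : 0 < m + 3 := by omega
  have hpos : ∀ k, ContinuousOn (fun x => max (f k x) 0) (sphere (0 : En (m + 3)) 1) :=
    fun k => (hf k).sup continuousOn_const
  have hneg : ∀ k, ContinuousOn (fun x => max (-f k x) 0) (sphere (0 : En (m + 3)) 1) :=
    fun k => (hf k).neg.sup continuousOn_const
  have habs : ∀ k, hessMat (Tg g fun x => |f k x|) u =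
      hessMat (Tg g fun x => max (f k x) 0) u + hessMat (Tg g fun x => max (-f k x) 0) u := by
    intro k
    rw [← hH.hessMat_Tg_add hn (hpos k) (hneg k) hu]
    simp only [max_zero_add_max_neg_zero_eq_abs_self]
  have hsub : ∀ k, hessMat (Tg g (f k)) u =
      hessMat (Tg g fun x => max (f k x) 0) u - hessMat (Tg g fun x => max (-f k x) 0) u := by
    intro k
    rw [eq_sub_iff_add_eq, ← hH.hessMat_Tg_add hn (hf k) (hneg k) hu]
    congr 2
    ext x
    rcases le_total (f k x) 0 with h | h <;> simp [h]
  simp only [hsub]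
  refine abs_restrDisc_sub_le hu
    (fun k => hH.posSemidef_hessMat_Tg (hpos k) hn (fun _ => le_max_right _ _) hu)
    (fun k => hH.posSemidef_hessMat_Tg (hneg k) hn (fun _ => le_max_right _ _) hu)
    (by rwa [← habs]) fun k _ => ?_
  rw [← habs]
  exact hH.posSemidef_smul_one_sub_hessMat_Tg (hf k).abs hn (supSph_nonneg _)
    (abs_le_supSph (hf k)) hu

lemma abs_restrDisc_le_boxN {m : ℕ} {H : En (m + 3) → ℝ} (hH : ZonalKernel H g)
    {f : Fin (m + 2) → En (m + 3) → ℝ}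
    (hf : ∀ k, ContinuousOn (f k) (sphere (0 : En (m + 3)) 1)) {u : En (m + 3)} (hu : ‖u‖ = 1) :
    |restrDisc u fun k => hessMat (Tg g (f k)) u| ≤
      boxN (Tg g fun x => |f 0 x|) u * ∏ k ∈ Finset.univ.erase 0, supSph (f k) := by
  have h := hH.abs_restrDisc_le hf hu (Y := hessMat (Tg g fun x => |f 0 x|) u)
    (by rw [sub_self]; exact Matrix.PosSemidef.zero)
  rw [hH.sum_hessMat_Tg_self (hf 0).abs (by omega) hu, sub_zero] at h
  rw [hH.boxN_Tg_eq_trace (hf 0).abs (by omega) hu]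
  convert h using 4
  push_cast
  ring

lemma abs_restrDisc_le_prod {m : ℕ} {H : En (m + 3) → ℝ} (hH : ZonalKernel H g)
    {f : Fin (m + 2) → En (m + 3) → ℝ}
    (hf : ∀ k, ContinuousOn (f k) (sphere (0 : En (m + 3)) 1)) {u : En (m + 3)} (hu : ‖u‖ = 1) :
    |restrDisc u fun k => hessMat (Tg g (f k)) u| ≤ ∏ k, supSph (f k) := by
  have h := hH.abs_restrDisc_le hf hu
    (hH.posSemidef_smul_one_sub_hessMat_Tg (hf 0).abs (by omega) (supSph_nonneg _)
      (abs_le_supSph (hf 0)) hu)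
  have h1 : ∑ i, ∑ j, (supSph (f 0) • (1 : Matrix (Fin (m + 3)) (Fin (m + 3)) ℝ)) i j *
      u i * u j = supSph (f 0) := by
    have h2 : ∑ i, u i ^ 2 = 1 := by
      have := EuclideanSpace.norm_sq_eq u
      simpa [hu] using this.symm
    simp [Matrix.one_apply, mul_assoc, ← Finset.mul_sum, ← pow_two, h2]
  rw [h1, Matrix.trace_smul, Matrix.trace_one, Fintype.card_fin] at h
  rw [← Finset.mul_prod_erase _ _ (Finset.mem_univ (0 : Fin (m + 2)))]
  convert h using 2
  have : (m : ℝ) + 2 ≠ 0 := by positivity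
  simp only [smul_eq_mul]
  push_cast
  field_simp
  ring

end ZonalKernel
end Bounds

section MeanSquare

open Laplacian

lemma laplacian_eq_sum_isometry (F : En n → ℝ) (ρ : En n ≃ₗᵢ[ℝ] En n) (x : En n) :
    Δ F x = ∑ j, fderiv ℝ (fderiv ℝ F) x (ρ (EuclideanSpace.single j 1))
      (ρ (EuclideanSpace.single j 1)) := by
  rw [InnerProductSpace.laplacian_eq_iteratedFDeriv_orthonormalBasis F
    ((EuclideanSpace.basisFun (Fin n) ℝ).map ρ)]
  simp [iteratedFDeriv_two_apply]

lemma laplacian_poleRefl (F : En n → ℝ) (v u : En n) :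
    Δ F (poleRefl v u) = ∑ j, fderiv ℝ (fderiv ℝ F) (poleRefl v u)
      (poleRefl v (EuclideanSpace.single j 1)) (poleRefl v (EuclideanSpace.single j 1)) :=
  laplacian_eq_sum_isometry F (poleRefl v) _

lemma measurable_poleRefl_prod :
    Measurable fun p : Sph n × Sph n => poleRefl (p.2 : En n) (p.1 : En n) := by
  simp_rw [poleRefl_apply]
  fun_prop

namespace ZonalKernel

variable {H : En n → ℝ} {g : ℝ → ℝ} (hH : ZonalKernel H g)
include hH

lemma laplacian_nonneg {u : En n} (hu : ‖u‖ = 1) : 0 ≤ Δ H u := by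
  rw [laplacian_eq_sum_isometry H (LinearIsometryEquiv.refl ℝ _)]
  exact Finset.sum_nonneg fun j _ => hH.hess_nonneg hu _

lemma continuousOn_laplacian : ContinuousOn (Δ H) {0}ᶜ := by
  have h : Δ H = fun x => ∑ j, fderiv ℝ (fderiv ℝ H) x (EuclideanSpace.single j 1)
      (EuclideanSpace.single j 1) :=
    funext (laplacian_eq_sum_isometry H (LinearIsometryEquiv.refl ℝ _))
  rw [h]
  exact continuousOn_finsetSum _ fun j _ =>
    (hH.continuousOn_fderiv_fderiv.clm_apply continuousOn_const).clm_apply continuousOn_const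

lemma integrable_mul_laplacian_prod {f : En n → ℝ} (hf : ContinuousOn f (sphere (0 : En n) 1)) :
    Integrable (fun p : Sph n × Sph n => f p.2 * Δ H (poleRefl (p.2 : En n) (p.1 : En n)))
      ((sphVol n).prod (sphVol n)) := by
  obtain ⟨C, hC0, hC⟩ := exists_norm_le_of_annulus hH.continuousOn_laplacian one_pos 1
  refine Integrable.of_bound (C := supSph f * C) (Measurable.aestronglyMeasurable ?_)
    (ae_of_all _ fun p => ?_)
  · exact ((continuous_coe_sphere hf).measurable.comp measurable_snd).mul
      ((measurable_of_continuousOn_compl_singleton 0 hH.continuousOn_laplacian).comp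
        measurable_poleRefl_prod)
  · rw [norm_mul]
    exact mul_le_mul (abs_le_supSph hf p.2) (hC _ (by simp) (by simp)) (norm_nonneg _)
      (supSph_nonneg f)

lemma integrable_mul_laplacian {f : En n → ℝ} (hf : ContinuousOn f (sphere (0 : En n) 1))
    {u : En n} (hu : ‖u‖ = 1) :
    Integrable (fun v : Sph n => f v * Δ H (poleRefl (v : En n) u)) (sphVol n) := by
  have hu0 : u ≠ 0 := norm_ne_zero_iff.1 (by simp [hu])
  simp only [laplacian_poleRefl, Finset.mul_sum]
  exact integrable_finsetSum _ fun j _ => hH.integrable_hess hf hu0 _ _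

lemma boxN_Tg_eq_integral (hn : 2 ≤ n) {f : En n → ℝ}
    (hf : ContinuousOn f (sphere (0 : En n) 1)) {u : En n} (hu : ‖u‖ = 1) :
    boxN (Tg g f) u =
      ((n : ℝ) - 1)⁻¹ * ∫ v : Sph n, f v * Δ H (poleRefl (v : En n) u) ∂(sphVol n) := by
  have hu0 : u ≠ 0 := norm_ne_zero_iff.1 (by simp [hu])
  rw [hH.boxN_Tg_eq_trace hf hn hu, Matrix.trace]
  simp only [Matrix.diag_apply, hessMat_eq, Matrix.of_apply,
    hH.fderiv_fderiv_Tg hf (by omega) hu0]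
  rw [← integral_finsetSum _ fun j _ => hH.integrable_hess hf hu0 _ _]
  simp only [laplacian_poleRefl, Finset.mul_sum]

lemma integral_laplacian_poleRefl (hn : 0 < n) {u : En n} (hu : ‖u‖ = 1) :
    ∫ v : Sph n, Δ H (poleRefl (v : En n) u) ∂(sphVol n) = (n : ℝ) - 1 := by
  have hu0 : u ≠ 0 := norm_ne_zero_iff.1 (by simp [hu])
  simp only [laplacian_poleRefl]
  rw [integral_finsetSum]
  · simp only [hH.integral_hess hn hu, ← pow_two, Finset.sum_sub_distrib, sum_inner_single_sq, hu]
    simp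
  · intro j _
    simpa using hH.integrable_hess (f := fun _ => 1) continuousOn_const hu0 _ _

lemma integral_laplacian (hn : 0 < n) : ∫ u : Sph n, Δ H u ∂(sphVol n) = (n : ℝ) - 1 := by
  have h := integral_integral_swap (f := fun u v : Sph n => Δ H (poleRefl (v : En n) (u : En n)))
    (μ := sphVol n) (ν := sphVol n)
    (by simpa [Function.uncurry_def] using
      hH.integrable_mul_laplacian_prod (f := fun _ => 1) continuousOn_const)
  simp only [fun u : Sph n => hH.integral_laplacian_poleRefl hn (u := u) (by simp),
    fun v : Sph n => integral_sphere_comp (poleRefl (v : En n)) (Δ H), integral_const,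
    smul_eq_mul] at h
  have h0 : (sphVol n).real Set.univ ≠ 0 := by
    have : NeZero (sphVol n) := ⟨fun h1 => by simpa [h1] using hH.integral_eq_one⟩
    exact measureReal_univ_ne_zero
  exact (mul_left_cancel₀ h0 h).symm

lemma integral_integral_mul_laplacian (hn : 0 < n) {f : En n → ℝ}
    (hf : ContinuousOn f (sphere (0 : En n) 1)) :
    ∫ u : Sph n, ∫ v : Sph n, f v * Δ H (poleRefl (v : En n) (u : En n)) ∂(sphVol n) ∂(sphVol n) =
      ((n : ℝ) - 1) * ∫ v : Sph n, f v ∂(sphVol n) := by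
  rw [integral_integral_swap (hH.integrable_mul_laplacian_prod hf)]
  simp only [integral_const_mul,
    fun v : Sph n => integral_sphere_comp (poleRefl (v : En n)) (Δ H), hH.integral_laplacian hn]
  rw [integral_mul_const, mul_comm]

/-- Jensen's inequality for the averaging operator `boxN ∘ Tg g`. -/
lemma boxN_Tg_abs_sq_le (hn : 2 ≤ n) {f : En n → ℝ}
    (hf : ContinuousOn f (sphere (0 : En n) 1)) {u : En n} (hu : ‖u‖ = 1) :
    boxN (Tg g fun x => |f x|) u ^ 2 ≤
      ((n : ℝ) - 1)⁻¹ * ∫ v : Sph n, f v ^ 2 * Δ H (poleRefl (v : En n) u) ∂(sphVol n) := by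
  have hn1 : (0 : ℝ) < (n : ℝ) - 1 := by
    have : (2 : ℝ) ≤ n := by exact_mod_cast hn
    linarith
  set b := boxN (Tg g fun x => |f x|) u with hb
  have hbI : ∫ v : Sph n, |f v| * Δ H (poleRefl (v : En n) u) ∂(sphVol n) = ((n : ℝ) - 1) * b := by
    rw [hb, hH.boxN_Tg_eq_integral hn hf.abs hu, mul_inv_cancel_left₀ hn1.ne']
  have h0 : 0 ≤ ∫ v : Sph n, (|f v| - b) ^ 2 * Δ H (poleRefl (v : En n) u) ∂(sphVol n) :=
    integral_nonneg fun v => mul_nonneg (sq_nonneg _) (hH.laplacian_nonneg (by simpa using hu))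
  have h1 : ∀ v : Sph n, (|f v| - b) ^ 2 * Δ H (poleRefl (v : En n) u) =
      f v ^ 2 * Δ H (poleRefl (v : En n) u) - (2 * b) * (|f v| * Δ H (poleRefl (v : En n) u)) +
        b ^ 2 * Δ H (poleRefl (v : En n) u) := by
    intro v
    rw [← sq_abs (f v)]
    ring
  have hf2 : ContinuousOn (fun x => f x ^ 2) (sphere (0 : En n) 1) := hf.pow 2
  have i1 := hH.integrable_mul_laplacian hf2 hu
  have i2 := (hH.integrable_mul_laplacian hf.abs hu).const_mul (2 * b)
  have i3 := hH.integrable_mul_laplacian (f := fun _ => b ^ 2) continuousOn_const hu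
  simp only [h1] at h0
  rw [integral_add (by exact i1.sub i2) i3, integral_sub i1 i2, integral_const_mul,
    integral_const_mul, hbI, hH.integral_laplacian_poleRefl (by omega) hu] at h0
  rw [inv_mul_eq_div, le_div_iff₀ hn1]
  linarith

lemma integral_sq_le_of_abs_le_boxN (hn : 2 ≤ n) {f G : En n → ℝ}
    (hf : ContinuousOn f (sphere (0 : En n) 1)) {P : ℝ}
    (hG : ∀ u : En n, ‖u‖ = 1 → |G u| ≤ boxN (Tg g fun x => |f x|) u * P) :
    ∫ u : Sph n, G u ^ 2 ∂(sphVol n) ≤ (∫ u : Sph n, f u ^ 2 ∂(sphVol n)) * P ^ 2 := by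
  have hn1 : (n : ℝ) - 1 ≠ 0 := by
    have : (2 : ℝ) ≤ n := by exact_mod_cast hn
    linarith
  have hf2 : ContinuousOn (fun x => f x ^ 2) (sphere (0 : En n) 1) := hf.pow 2
  have hi := ((hH.integrable_mul_laplacian_prod hf2).integral_prod_left.const_mul
    ((n : ℝ) - 1)⁻¹).mul_const (P ^ 2)
  calc _ ≤ _ := integral_mono_of_nonneg (ae_of_all _ fun u => sq_nonneg _) hi
        (ae_of_all _ fun u : Sph n => ?_)
    _ = _ := by
      rw [integral_mul_const, integral_const_mul,
        hH.integral_integral_mul_laplacian (by omega) hf2, inv_mul_cancel_left₀ hn1]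
  have h1 := hG u (by simp)
  calc G u ^ 2 = |G u| ^ 2 := (sq_abs _).symm
    _ ≤ (boxN (Tg g fun x => |f x|) u * P) ^ 2 := pow_le_pow_left₀ (abs_nonneg _) h1 2
    _ ≤ _ := by
      rw [mul_pow]
      exact mul_le_mul_of_nonneg_right (hH.boxN_Tg_abs_sq_le hn hf (by simp)) (sq_nonneg P)

end ZonalKernel
end MeanSquare

section Main

lemma legendreP_zero (hn : 2 ≤ n) {t : ℝ} (ht : |t| < 1) : legendreP n 0 t = 1 := by
  have hn1 : (0 : ℝ) < ((n : ℝ) - 1) / 2 := by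
    have : (2 : ℝ) ≤ n := by exact_mod_cast hn
    linarith
  have ht1 : 0 < 1 - t ^ 2 := by
    have := (sq_lt_one_iff_abs_lt_one t).2 ht
    linarith
  have hG := (Real.Gamma_pos_of_pos hn1).ne'
  simp only [legendreP, iteratedDeriv_zero, pow_zero, one_mul, Nat.cast_zero, add_zero]
  rw [div_self hG, one_mul, Real.rpow_neg ht1.le, inv_mul_cancel₀ (Real.rpow_pos_of_pos ht1 _).ne']

lemma multSph_zero (hn : 2 ≤ n) (F : En n → ℝ) :
    multSph 0 F = ∫ v : Sph n, F v ∂(sphVol n) := by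
  have hp : ‖pole n‖ = 1 := norm_pole (by omega)
  refine integral_congr_ae ?_
  have h1 := sphVol_singleton hn ⟨pole n, by simp [hp]⟩
  have h2 := sphVol_singleton hn ⟨-pole n, by simp [hp]⟩
  filter_upwards [measure_eq_zero_iff_ae_notMem.1 h1, measure_eq_zero_iff_ae_notMem.1 h2]
    with v hv1 hv2
  have hv : ‖(v : En n)‖ = 1 := by simp
  rw [legendreP_zero hn, mul_one]
  refine abs_lt.2 ⟨?_, ?_⟩
  · rw [neg_lt, ← inner_neg_left, inner_lt_one_iff_real_of_norm_eq_one (by simpa using hp) hv]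
    exact fun h => hv2 (Subtype.ext h.symm)
  · rw [inner_lt_one_iff_real_of_norm_eq_one hp hv]
    exact fun h => hv1 (Subtype.ext h.symm)

lemma supp_smul (K : ConvexBody (En n)) (t : ℝ) (ht : 0 < t) (x : En n) :
    supp K (t • x) = t * supp K x := by
  rw [supp, supp, ← smul_eq_mul, ← Real.sSup_smul_of_nonneg ht.le, ← Set.image_smul,
    Set.image_image]
  simp only [real_inner_smul_left, smul_eq_mul]

lemma zonalKernel_supp (hn : 2 ≤ n) {L : ConvexBody (En n)} {g : ℝ → ℝ} (hL : IsCkPlus 2 L)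
    (hprof : ∀ u : En n, ‖u‖ = 1 → supp L u = g ⟪u, pole n⟫_ℝ)
    (hnorm : multSph 0 (supp L) = 1) : ZonalKernel (supp L) g where
  contDiffOn := hL.1
  map_smul := supp_smul L
  profile := hprof
  nonneg_of_orthogonal u w hu huw := by
    rcases eq_or_ne w 0 with rfl | hw
    · simp
    · have h := hL.2 u hu w hw huw
      rw [hessQ, iteratedFDeriv_two_apply] at h
      exact h.le
  integral_eq_one := by rw [← multSph_zero hn, hnorm]

end Main

/-- **Lemma 3.7.** `L²` and sup bounds for the multilinear map
`(f₁,…,f_{n-1}) ↦ D(D²T_L f₁,…,D²T_L f_{n-1})`. -/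
theorem mixed_discriminant_L2_sup_bounds
    (n : ℕ) (hn : 3 ≤ n)
    (L : ConvexBody (En n)) (g : ℝ → ℝ)
    (hLsym : scale (-1) L = L)
    (hLzonal : IsZonalBody L)
    (hLC2 : IsCkPlus 2 L)
    (hprof : ∀ u : En n, ‖u‖ = 1 → supp L u = g ⟪u, pole n⟫_ℝ)
    (hnorm : multSph 0 (supp L) = 1)
    (f : Fin (n - 1) → (En n → ℝ))
    (hf : ∀ k, ContinuousOn (f k) (sphere (0 : En n) 1)) :
    (∀ u : En n, ‖u‖ = 1 →
      |restrDisc u fun k => hessMat (Tg g (f k)) u| ≤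
        |boxN (Tg g fun x => |f ⟨0, by omega⟩ x|) u| *
          ∏ k ∈ Finset.univ.erase (⟨0, by omega⟩ : Fin (n - 1)), supSph (f k)) ∧
    sphL2 (fun u => restrDisc u fun k => hessMat (Tg g (f k)) u) ≤
      sphL2 (f ⟨0, by omega⟩) *
        ∏ k ∈ Finset.univ.erase (⟨0, by omega⟩ : Fin (n - 1)), supSph (f k) ∧
    supSph (fun u => restrDisc u fun k => hessMat (Tg g (f k)) u) ≤
      ∏ k, supSph (f k) := by
  have hH := zonalKernel_supp (by omega) hLC2 hprof hnorm
  obtain ⟨m, rfl⟩ : ∃ m, n = m + 3 := ⟨n - 3, by omega⟩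
  have hP : ∀ s : Finset (Fin (m + 2)), 0 ≤ ∏ k ∈ s, supSph (f k) :=
    fun s => Finset.prod_nonneg fun k _ => supSph_nonneg _
  have hbox := fun (u : En (m + 3)) (hu : ‖u‖ = 1) => hH.abs_restrDisc_le_boxN hf hu
  refine ⟨fun u hu => (hbox u hu).trans
    (mul_le_mul_of_nonneg_right (le_abs_self _) (hP _)), ?_, ?_⟩
  · have h := Real.sqrt_le_sqrt (hH.integral_sq_le_of_abs_le_boxN (by omega) (hf ⟨0, _⟩) hbox)
    rw [Real.sqrt_mul' _ (sq_nonneg _), Real.sqrt_sq (hP _)] at h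
    exact h
  · exact Real.iSup_le (fun u => hH.abs_restrDisc_le_prod hf (by simp)) (hP _)

end MinkIter
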